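/- If H1 is a central nebula and H2 is an LR-Δgalaxy, then there exists ε > 0 such that every {H1,H2}-free tournament T contains a transitive subtournament of size at least |T|^ε. -/

import Mathlib

open Finset

/-- A tournament on vertex set `Fin n`: `adj u v` means there is an arc from `u` to `v`. -/
structure Tournament (n : ℕ) where
  adj : Fin n → Fin n → Prop
  asymm : ∀ u v, adj u v → ¬ adj v u
  total : ∀ u v, u ≠ v → adj u v ∨ adj v u

namespace Tournament

variable {n N : ℕ}

/-- The position of vertex `v` in the ordering `θ`, where `θ k` is the `k`-th vertex. -/
def pos (θ : Equiv.Perm (Fin n)) (v : Fin n) : Fin n := θ.symm v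

/-- The arc `u → v` of `T` is a backward arc under the ordering `θ`. -/
def Backward (T : Tournament n) (θ : Equiv.Perm (Fin n)) (u v : Fin n) : Prop :=
  T.adj u v ∧ pos θ v < pos θ u

/-- `x` lies strictly between two elements of `L` under the ordering `θ`. -/
def BetweenSet (θ : Equiv.Perm (Fin n)) (L : Finset (Fin n)) (x : Fin n) : Prop :=
  ∃ u ∈ L, ∃ w ∈ L, pos θ u < pos θ x ∧ pos θ x < pos θ w

/-- The induced subtournament of `T` on `s` is transitive. -/
def IsTransOn (T : Tournament n) (s : Finset (Fin n)) : Prop :=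
  ∀ u ∈ s, ∀ v ∈ s, ∀ w ∈ s, T.adj u v → T.adj v w → T.adj u w

/-- The largest size of a transitive subtournament of `T` contained in `s`. -/
noncomputable def trSizeOn (T : Tournament n) (s : Finset (Fin n)) : ℕ :=
  sSup {k | ∃ t, t ⊆ s ∧ T.IsTransOn t ∧ t.card = k}

/-- `tr(T)`: the largest size of a transitive subtournament of `T`. -/
noncomputable def trSize (T : Tournament n) : ℕ := T.trSizeOn Finset.univ

/-- `T` contains `H`: some induced subtournament of `T` is isomorphic to `H`. -/
def Contains (T : Tournament N) (H : Tournament n) : Prop :=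
  ∃ f : Fin n ↪ Fin N, ∀ u v, H.adj u v ↔ T.adj (f u) (f v)

/-- `T` is `ε`-critical. -/
def EpsCritical (T : Tournament n) (ε : ℝ) : Prop :=
  ((T.trSize : ℝ) < (n : ℝ) ^ ε) ∧
  ∀ s : Finset (Fin n), s ≠ Finset.univ → ((s.card : ℝ) ^ ε ≤ (T.trSizeOn s : ℝ))

/-- `S` with center `c` is a right star of `T` under `θ`. -/
def IsRightStarAt (T : Tournament n) (θ : Equiv.Perm (Fin n)) (S : Finset (Fin n))
    (c : Fin n) : Prop :=
  c ∈ S ∧ (S.erase c).Nonempty ∧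
  (∀ v ∈ S.erase c, pos θ v < pos θ c ∧ T.adj c v) ∧
  (∀ u ∈ S, ∀ v ∈ S, T.Backward θ u v → u = c)

/-- `S` with center `c` is a left star of `T` under `θ`. -/
def IsLeftStarAt (T : Tournament n) (θ : Equiv.Perm (Fin n)) (S : Finset (Fin n))
    (c : Fin n) : Prop :=
  c ∈ S ∧ (S.erase c).Nonempty ∧
  (∀ v ∈ S.erase c, pos θ c < pos θ v ∧ T.adj v c) ∧
  (∀ u ∈ S, ∀ v ∈ S, T.Backward θ u v → v = c)

/-- `S` with center `c` is a middle star of `T` under `θ`. -/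
def IsMiddleStarAt (T : Tournament n) (θ : Equiv.Perm (Fin n)) (S : Finset (Fin n))
    (c : Fin n) : Prop :=
  c ∈ S ∧
  (∃ v ∈ S.erase c, pos θ v < pos θ c) ∧ (∃ v ∈ S.erase c, pos θ c < pos θ v) ∧
  (∀ v ∈ S.erase c, (pos θ v < pos θ c → T.adj c v) ∧ (pos θ c < pos θ v → T.adj v c)) ∧
  (∀ u ∈ S, ∀ v ∈ S, T.Backward θ u v → u = c ∨ v = c)

def IsFrontierStarAt (T : Tournament n) (θ : Equiv.Perm (Fin n)) (S : Finset (Fin n))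
    (c : Fin n) : Prop :=
  T.IsLeftStarAt θ S c ∨ T.IsRightStarAt θ S c

def IsStarAt (T : Tournament n) (θ : Equiv.Perm (Fin n)) (S : Finset (Fin n))
    (c : Fin n) : Prop :=
  T.IsLeftStarAt θ S c ∨ T.IsRightStarAt θ S c ∨ T.IsMiddleStarAt θ S c

/-- A middle star with exactly one leaf after the center (center is `u_{p-1}`). -/
def IsOneRightMiddleStarAt (T : Tournament n) (θ : Equiv.Perm (Fin n)) (S : Finset (Fin n))
    (c : Fin n) : Prop :=
  T.IsMiddleStarAt θ S c ∧ ((S.erase c).filter (fun v => pos θ c < pos θ v)).card = 1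

/-- A middle star with exactly one leaf before the center (center is `u_2`). -/
def IsOneLeftMiddleStarAt (T : Tournament n) (θ : Equiv.Perm (Fin n)) (S : Finset (Fin n))
    (c : Fin n) : Prop :=
  T.IsMiddleStarAt θ S c ∧ ((S.erase c).filter (fun v => pos θ v < pos θ c)).card = 1

/-- Kinds of super 2-nebulas. -/
inductive NebKind
  | left
  | middle
  | right

/-- Common requirements on the data of a super 2-nebula: vertex set `S`, centers `c₁, c₂`
(`c₁` before `c₂` under `θ`), leaves `L₁` incident to `c₁` and `L₂` incident to `c₂`. -/
def Super2NebCommon (θ : Equiv.Perm (Fin n)) (S : Finset (Fin n)) (c₁ c₂ : Fin n)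
    (L₁ L₂ : Finset (Fin n)) : Prop :=
  L₁.Nonempty ∧ L₂.Nonempty ∧ Disjoint L₁ L₂ ∧
  c₁ ∉ L₁ ∪ L₂ ∧ c₂ ∉ L₁ ∪ L₂ ∧ c₁ ≠ c₂ ∧
  S = insert c₁ (insert c₂ (L₁ ∪ L₂)) ∧ pos θ c₁ < pos θ c₂

/-- `S` is a super (left/middle/right) 2-nebula of `T` under `θ`, with centers `c₁, c₂` and
leaves `L₁` (incident to `c₁`) and `L₂` (incident to `c₂`). -/
def IsSuper2NebulaAt (T : Tournament n) (θ : Equiv.Perm (Fin n)) (S : Finset (Fin n))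
    (c₁ c₂ : Fin n) (L₁ L₂ : Finset (Fin n)) : NebKind → Prop
  | NebKind.middle =>
      Super2NebCommon θ S c₁ c₂ L₁ L₂ ∧
      (∀ v ∈ L₁ ∪ L₂, pos θ c₁ < pos θ v ∧ pos θ v < pos θ c₂) ∧
      (∀ v ∈ L₁, T.adj v c₁) ∧ (∀ v ∈ L₂, T.adj c₂ v) ∧ T.adj c₂ c₁ ∧
      (∀ u ∈ S, ∀ v ∈ S, T.Backward θ u v →
        (u ∈ L₁ ∧ v = c₁) ∨ (u = c₂ ∧ v ∈ L₂) ∨ (u = c₂ ∧ v = c₁))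
  | NebKind.left =>
      Super2NebCommon θ S c₁ c₂ L₁ L₂ ∧
      (∀ v ∈ L₁ ∪ L₂, pos θ v < pos θ c₁) ∧
      (∀ v ∈ L₁, T.adj c₁ v) ∧ (∀ v ∈ L₂, T.adj c₂ v) ∧ T.adj c₂ c₁ ∧
      (∀ u ∈ S, ∀ v ∈ S, T.Backward θ u v →
        (u = c₁ ∧ v ∈ L₁) ∨ (u = c₂ ∧ v ∈ L₂) ∨ (u = c₂ ∧ v = c₁))
  | NebKind.right =>
      Super2NebCommon θ S c₁ c₂ L₁ L₂ ∧
      (∀ v ∈ L₁ ∪ L₂, pos θ c₂ < pos θ v) ∧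
      (∀ v ∈ L₁, T.adj v c₁) ∧ (∀ v ∈ L₂, T.adj v c₂) ∧ T.adj c₂ c₁ ∧
      (∀ u ∈ S, ∀ v ∈ S, T.Backward θ u v →
        (u ∈ L₁ ∧ v = c₁) ∨ (u ∈ L₂ ∧ v = c₂) ∨ (u = c₂ ∧ v = c₁))

/-- A decomposition of `T` witnessing that `T` is a super nebula under `θ`, with stars
`Q i` (centers `ctr i`) and super 2-nebulas `Sig i` (centers `c₁ i, c₂ i`, leaves
`L₁ i, L₂ i`, of kind `kd i`). -/
def SuperNebulaDecomp (T : Tournament n) (θ : Equiv.Perm (Fin n)) {m l : ℕ}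
    (Q : Fin m → Finset (Fin n)) (ctr : Fin m → Fin n)
    (Sig : Fin l → Finset (Fin n)) (c₁ c₂ : Fin l → Fin n)
    (L₁ L₂ : Fin l → Finset (Fin n)) (kd : Fin l → NebKind) : Prop :=
  (∀ i, T.IsStarAt θ (Q i) (ctr i)) ∧
  (∀ i, T.IsSuper2NebulaAt θ (Sig i) (c₁ i) (c₂ i) (L₁ i) (L₂ i) (kd i)) ∧
  (∀ i j, i ≠ j → Disjoint (Q i) (Q j)) ∧
  (∀ i j, i ≠ j → Disjoint (Sig i) (Sig j)) ∧
  (∀ i j, Disjoint (Q i) (Sig j)) ∧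
  (∀ u v, T.Backward θ u v → (∃ i, u ∈ Q i ∧ v ∈ Q i) ∨ (∃ i, u ∈ Sig i ∧ v ∈ Sig i)) ∧
  (∀ i j, ¬ BetweenSet θ (L₁ j ∪ L₂ j) (ctr i)) ∧
  (∀ i j, i ≠ j → ¬ BetweenSet θ (L₁ j ∪ L₂ j) (c₁ i) ∧ ¬ BetweenSet θ (L₁ j ∪ L₂ j) (c₂ i))

/-- `T` is a super nebula. -/
def IsSuperNebula (T : Tournament n) : Prop :=
  ∃ (θ : Equiv.Perm (Fin n)) (m l : ℕ) (Q : Fin m → Finset (Fin n)) (ctr : Fin m → Fin n)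
    (Sig : Fin l → Finset (Fin n)) (c₁ c₂ : Fin l → Fin n)
    (L₁ L₂ : Fin l → Finset (Fin n)) (kd : Fin l → NebKind),
    SuperNebulaDecomp T θ Q ctr Sig c₁ c₂ L₁ L₂ kd

/-- `{a, b, c}` (in this position order) is a triangle of `T` under `θ`:
`a` is the left exterior, `b` the center, `c` the right exterior. -/
def IsTriangleAt (T : Tournament n) (θ : Equiv.Perm (Fin n)) (a b c : Fin n) : Prop :=
  pos θ a < pos θ b ∧ pos θ b < pos θ c ∧ T.adj b a ∧ T.adj c a ∧ T.adj c b

/-- A decomposition of `T` under `θ` into triangles `{A i, B i, C i}` (left exterior, center,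
right exterior) and frontier stars `Q j` with centers `ctr j`, where for each triangle `i`,
the vertices in `forb i` are not allowed to lie between leaves of a star. -/
def TriGalaxyDecomp (T : Tournament n) (θ : Equiv.Perm (Fin n)) {l k : ℕ}
    (A B C : Fin l → Fin n) (Q : Fin k → Finset (Fin n)) (ctr : Fin k → Fin n)
    (forb : Fin l → Finset (Fin n)) : Prop :=
  (∀ i, T.IsTriangleAt θ (A i) (B i) (C i)) ∧
  (∀ j, T.IsFrontierStarAt θ (Q j) (ctr j)) ∧
  (∀ i j, i ≠ j →
    Disjoint ({A i, B i, C i} : Finset (Fin n)) ({A j, B j, C j} : Finset (Fin n))) ∧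
  (∀ i j, Disjoint ({A i, B i, C i} : Finset (Fin n)) (Q j)) ∧
  (∀ i j, i ≠ j → Disjoint (Q i) (Q j)) ∧
  (∀ u v, T.Backward θ u v →
    (∃ i, u ∈ ({A i, B i, C i} : Finset (Fin n)) ∧ v ∈ ({A i, B i, C i} : Finset (Fin n))) ∨
    (∃ j, u ∈ Q j ∧ v ∈ Q j)) ∧
  (∀ i j, i ≠ j → ¬ BetweenSet θ ((Q j).erase (ctr j)) (ctr i)) ∧
  (∀ i j, ∀ x ∈ forb i, ¬ BetweenSet θ ((Q j).erase (ctr j)) x)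

/-- `T` is a Δgalaxy: a triangular galaxy with exactly one triangle. -/
def IsDeltaGalaxy (T : Tournament n) : Prop :=
  ∃ (θ : Equiv.Perm (Fin n)) (a b c : Fin n) (k : ℕ)
    (Q : Fin k → Finset (Fin n)) (ctr : Fin k → Fin n),
    TriGalaxyDecomp T θ (fun _ : Fin 1 => a) (fun _ => b) (fun _ => c) Q ctr
      (fun _ => ({a, b, c} : Finset (Fin n)))

/-- `T` is a central triangular galaxy: centers of triangles may lie between leaves of stars. -/
def IsCentralTriangularGalaxy (T : Tournament n) : Prop :=
  ∃ (θ : Equiv.Perm (Fin n)) (l k : ℕ) (A B C : Fin l → Fin n)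
    (Q : Fin k → Finset (Fin n)) (ctr : Fin k → Fin n),
    TriGalaxyDecomp T θ A B C Q ctr (fun i => ({A i, C i} : Finset (Fin n)))

/-- `T` is a left triangular galaxy: left exteriors of triangles may lie between leaves. -/
def IsLeftTriangularGalaxy (T : Tournament n) : Prop :=
  ∃ (θ : Equiv.Perm (Fin n)) (l k : ℕ) (A B C : Fin l → Fin n)
    (Q : Fin k → Finset (Fin n)) (ctr : Fin k → Fin n),
    TriGalaxyDecomp T θ A B C Q ctr (fun i => ({B i, C i} : Finset (Fin n)))

/-- `T` is a right triangular galaxy: right exteriors of triangles may lie between leaves. -/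
def IsRightTriangularGalaxy (T : Tournament n) : Prop :=
  ∃ (θ : Equiv.Perm (Fin n)) (l k : ℕ) (A B C : Fin l → Fin n)
    (Q : Fin k → Finset (Fin n)) (ctr : Fin k → Fin n),
    TriGalaxyDecomp T θ A B C Q ctr (fun i => ({A i, B i} : Finset (Fin n)))

/-- A decomposition of `T` witnessing that `T` is a nebula under `θ` (no condition on the
location of the centers of the stars). -/
def NebulaDecomp (T : Tournament n) (θ : Equiv.Perm (Fin n)) {k : ℕ}
    (Q : Fin k → Finset (Fin n)) (ctr : Fin k → Fin n) : Prop :=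
  (∀ i, T.IsStarAt θ (Q i) (ctr i)) ∧
  (∀ i j, i ≠ j → Disjoint (Q i) (Q j)) ∧
  (∀ u v, T.Backward θ u v → ∃ i, u ∈ Q i ∧ v ∈ Q i)

/-- `T` is a central nebula: a nebula all of whose stars are 3-vertex middle stars. -/
def IsCentralNebula (T : Tournament n) : Prop :=
  ∃ (θ : Equiv.Perm (Fin n)) (k : ℕ) (Q : Fin k → Finset (Fin n)) (ctr : Fin k → Fin n),
    NebulaDecomp T θ Q ctr ∧ ∀ i, T.IsMiddleStarAt θ (Q i) (ctr i) ∧ (Q i).card = 3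

/-- `T` is a super left nebula: a nebula all of whose stars are left stars. -/
def IsSuperLeftNebula (T : Tournament n) : Prop :=
  ∃ (θ : Equiv.Perm (Fin n)) (k : ℕ) (Q : Fin k → Finset (Fin n)) (ctr : Fin k → Fin n),
    NebulaDecomp T θ Q ctr ∧ ∀ i, T.IsLeftStarAt θ (Q i) (ctr i)

/-- `T` is a super right nebula: a nebula all of whose stars are right stars. -/
def IsSuperRightNebula (T : Tournament n) : Prop :=
  ∃ (θ : Equiv.Perm (Fin n)) (k : ℕ) (Q : Fin k → Finset (Fin n)) (ctr : Fin k → Fin n),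
    NebulaDecomp T θ Q ctr ∧ ∀ i, T.IsRightStarAt θ (Q i) (ctr i)

/-- `T` is an LR-Δgalaxy: a super Δgalaxy in which only the two exteriors of the triangle
may lie between leaves of a star. -/
def IsLRDeltaGalaxy (T : Tournament n) : Prop :=
  ∃ (θ : Equiv.Perm (Fin n)) (a b c : Fin n) (k : ℕ)
    (Q : Fin k → Finset (Fin n)) (ctr : Fin k → Fin n),
    TriGalaxyDecomp T θ (fun _ : Fin 1 => a) (fun _ => b) (fun _ => c) Q ctr
      (fun _ => ({b} : Finset (Fin n)))

/-- `T` is a CR-Δgalaxy. -/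
def IsCRDeltaGalaxy (T : Tournament n) : Prop :=
  ∃ (θ : Equiv.Perm (Fin n)) (a b c : Fin n) (k : ℕ)
    (Q : Fin k → Finset (Fin n)) (ctr : Fin k → Fin n),
    TriGalaxyDecomp T θ (fun _ : Fin 1 => a) (fun _ => b) (fun _ => c) Q ctr
      (fun _ => ({a} : Finset (Fin n))) ∧
    (∀ i j, i ≠ j → BetweenSet θ ((Q i).erase (ctr i)) b →
      BetweenSet θ ((Q j).erase (ctr j)) c →
      (∀ x ∈ (Q i).erase (ctr i), ¬ BetweenSet θ ((Q j).erase (ctr j)) x) ∧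
      (∀ x ∈ (Q j).erase (ctr j), ¬ BetweenSet θ ((Q i).erase (ctr i)) x)) ∧
    (∀ i, BetweenSet θ ((Q i).erase (ctr i)) b → ¬ BetweenSet θ ((Q i).erase (ctr i)) c)

/-- `T` is a CL-Δgalaxy. -/
def IsCLDeltaGalaxy (T : Tournament n) : Prop :=
  ∃ (θ : Equiv.Perm (Fin n)) (a b c : Fin n) (k : ℕ)
    (Q : Fin k → Finset (Fin n)) (ctr : Fin k → Fin n),
    TriGalaxyDecomp T θ (fun _ : Fin 1 => a) (fun _ => b) (fun _ => c) Q ctr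
      (fun _ => ({c} : Finset (Fin n))) ∧
    (∀ i j, i ≠ j → BetweenSet θ ((Q i).erase (ctr i)) b →
      BetweenSet θ ((Q j).erase (ctr j)) a →
      (∀ x ∈ (Q i).erase (ctr i), ¬ BetweenSet θ ((Q j).erase (ctr j)) x) ∧
      (∀ x ∈ (Q j).erase (ctr j), ¬ BetweenSet θ ((Q i).erase (ctr i)) x)) ∧
    (∀ i, BetweenSet θ ((Q i).erase (ctr i)) b → ¬ BetweenSet θ ((Q i).erase (ctr i)) a)

/-- A decomposition of `T` under `θ` into one super 2-nebula (of kind `kd`) and frontier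
stars, covering all of `V(T)`, witnessing that `T` is a Σ-galaxy under `θ`. -/
def SigmaGalaxyDecomp (T : Tournament n) (θ : Equiv.Perm (Fin n))
    (S : Finset (Fin n)) (c₁ c₂ : Fin n) (L₁ L₂ : Finset (Fin n)) (kd : NebKind)
    {m : ℕ} (Q : Fin m → Finset (Fin n)) (ctr : Fin m → Fin n) : Prop :=
  T.IsSuper2NebulaAt θ S c₁ c₂ L₁ L₂ kd ∧
  (∀ j, T.IsFrontierStarAt θ (Q j) (ctr j)) ∧
  (∀ i j, i ≠ j → Disjoint (Q i) (Q j)) ∧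
  (∀ j, Disjoint S (Q j)) ∧
  (∀ v, v ∈ S ∨ ∃ j, v ∈ Q j) ∧
  (∀ u v, T.Backward θ u v → (u ∈ S ∧ v ∈ S) ∨ ∃ j, u ∈ Q j ∧ v ∈ Q j) ∧
  (∀ j, ¬ BetweenSet θ (L₁ ∪ L₂) (ctr j)) ∧
  (∀ j, ¬ BetweenSet θ ((Q j).erase (ctr j)) c₁ ∧ ¬ BetweenSet θ ((Q j).erase (ctr j)) c₂) ∧
  (∀ i j, i ≠ j → ¬ BetweenSet θ ((Q j).erase (ctr j)) (ctr i))

def IsMiddleSigmaGalaxy (T : Tournament n) : Prop :=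
  ∃ (θ : Equiv.Perm (Fin n)) (S : Finset (Fin n)) (c₁ c₂ : Fin n) (L₁ L₂ : Finset (Fin n))
    (m : ℕ) (Q : Fin m → Finset (Fin n)) (ctr : Fin m → Fin n),
    SigmaGalaxyDecomp T θ S c₁ c₂ L₁ L₂ NebKind.middle Q ctr

def IsLeftSigmaGalaxy (T : Tournament n) : Prop :=
  ∃ (θ : Equiv.Perm (Fin n)) (S : Finset (Fin n)) (c₁ c₂ : Fin n) (L₁ L₂ : Finset (Fin n))
    (m : ℕ) (Q : Fin m → Finset (Fin n)) (ctr : Fin m → Fin n),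
    SigmaGalaxyDecomp T θ S c₁ c₂ L₁ L₂ NebKind.left Q ctr

def IsRightSigmaGalaxy (T : Tournament n) : Prop :=
  ∃ (θ : Equiv.Perm (Fin n)) (S : Finset (Fin n)) (c₁ c₂ : Fin n) (L₁ L₂ : Finset (Fin n))
    (m : ℕ) (Q : Fin m → Finset (Fin n)) (ctr : Fin m → Fin n),
    SigmaGalaxyDecomp T θ S c₁ c₂ L₁ L₂ NebKind.right Q ctr

/-- The directed density from `X` to `Y`. -/
noncomputable def density (T : Tournament n) (X Y : Finset (Fin n)) : ℝ :=
  (Set.ncard {p : Fin n × Fin n | p.1 ∈ X ∧ p.2 ∈ Y ∧ T.adj p.1 p.2} : ℝ) /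
    ((X.card : ℝ) * (Y.card : ℝ))

/-- `(S i)` is a smooth `(c, lam, w)`-structure of `T`. -/
def IsSmoothStructure (T : Tournament n) (c lam : ℝ) {N : ℕ} (w : Fin N → Bool)
    (S : Fin N → Finset (Fin n)) : Prop :=
  (∀ i j, i ≠ j → Disjoint (S i) (S j)) ∧
  (∀ i, w i = false → c * (n : ℝ) ≤ ((S i).card : ℝ)) ∧
  (∀ i, w i = true → T.IsTransOn (S i) ∧ c * (T.trSize : ℝ) ≤ ((S i).card : ℝ)) ∧
  (∀ i j, i < j →
    (∀ v ∈ S i, 1 - lam ≤ T.density {v} (S j)) ∧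
    (∀ v ∈ S j, 1 - lam ≤ T.density (S i) {v}))

end Tournament

/-- The backward arcs of `K₆` under its canonical ordering. -/
def K6back : List (ℕ × ℕ) := [(3, 0), (5, 2), (5, 0), (4, 1)]

/-- The tournament `K₆`, on `Fin 6` with its canonical ordering. -/
def K6 : Tournament 6 where
  adj u v := (u.val, v.val) ∈ K6back ∨ (u < v ∧ (v.val, u.val) ∉ K6back)
  asymm := by decide
  total := by decide

/-- The pair `{H₁, H₂}` satisfies the Erdős–Hajnal conjecture: there is `ε > 0` such that
every `{H₁, H₂}`-free tournament `T` has a transitive subtournament of size `≥ |T| ^ ε`. -/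
def EHPair {n₁ n₂ : ℕ} (H₁ : Tournament n₁) (H₂ : Tournament n₂) : Prop :=
  ∃ ε : ℝ, 0 < ε ∧ ∀ (n : ℕ) (T : Tournament n),
    ¬ T.Contains H₁ → ¬ T.Contains H₂ → (n : ℝ) ^ ε ≤ (T.trSize : ℝ)

open Tournament

namespace Tournament

section ErdosHajnal

open scoped Classical

/-! ### Transitive sets -/

theorem not_adj_self {n : ℕ} (T : Tournament n) (u : Fin n) : ¬ T.adj u u :=
  fun h => T.asymm u u h h

theorem ne_of_adj {n : ℕ} (T : Tournament n) {u v : Fin n} (h : T.adj u v) : u ≠ v := by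
  rintro rfl
  exact T.not_adj_self u h

theorem adj_of_not_adj {n : ℕ} (T : Tournament n) {u v : Fin n} (hne : u ≠ v)
    (h : ¬ T.adj v u) : T.adj u v :=
  (T.total u v hne).resolve_right h

theorem IsTransOn.mono {n : ℕ} {T : Tournament n} {s t : Finset (Fin n)} (ht : T.IsTransOn t)
    (hst : s ⊆ t) : T.IsTransOn s :=
  fun u hu v hv w hw => ht u (hst hu) v (hst hv) w (hst hw)

theorem IsTransOn.union {n : ℕ} {T : Tournament n} {A B : Finset (Fin n)} (hA : T.IsTransOn A)
    (hB : T.IsTransOn B) (h : ∀ a ∈ A, ∀ b ∈ B, T.adj a b) : T.IsTransOn (A ∪ B) := by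
  intro u hu v hv w hw huv hvw
  rw [mem_union] at hu hv hw
  rcases hu with hu | hu <;> rcases hv with hv | hv <;> rcases hw with hw | hw
  · exact hA u hu v hv w hw huv hvw
  · exact h u hu w hw
  · exact absurd hvw (T.asymm _ _ (h w hw v hv))
  · exact h u hu w hw
  · exact absurd huv (T.asymm _ _ (h v hv u hu))
  · exact absurd huv (T.asymm _ _ (h v hv u hu))
  · exact absurd hvw (T.asymm _ _ (h w hw v hv))
  · exact hB u hu v hv w hw huv hvw

theorem bddAbove_trans_card {n : ℕ} (T : Tournament n) (s : Finset (Fin n)) :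
    BddAbove {k | ∃ t, t ⊆ s ∧ T.IsTransOn t ∧ t.card = k} := by
  refine ⟨#s, ?_⟩
  rintro k ⟨t, hts, -, rfl⟩
  exact card_le_card hts

theorem IsTransOn.card_le_trSizeOn {n : ℕ} {T : Tournament n} {s t : Finset (Fin n)}
    (ht : T.IsTransOn t) (hts : t ⊆ s) : #t ≤ T.trSizeOn s :=
  le_csSup (T.bddAbove_trans_card s) ⟨t, hts, ht, rfl⟩

theorem exists_isTransOn_card_eq {n : ℕ} (T : Tournament n) (s : Finset (Fin n)) :
    ∃ t ⊆ s, T.IsTransOn t ∧ #t = T.trSizeOn s := by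
  have hne : {k | ∃ t, t ⊆ s ∧ T.IsTransOn t ∧ t.card = k}.Nonempty :=
    ⟨0, ∅, empty_subset s, fun u hu => absurd hu (notMem_empty u), rfl⟩
  obtain ⟨t, hts, ht, hk⟩ := Nat.sSup_mem hne (T.bddAbove_trans_card s)
  exact ⟨t, hts, ht, hk⟩

theorem isTransOn_singleton {n : ℕ} (T : Tournament n) (v : Fin n) : T.IsTransOn {v} := by
  intro a ha b hb c _ hab
  rw [mem_singleton] at ha hb
  subst ha hb
  exact absurd hab (T.not_adj_self _)

theorem one_le_trSizeOn {n : ℕ} (T : Tournament n) {s : Finset (Fin n)} (hs : s.Nonempty) :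
    1 ≤ T.trSizeOn s := by
  obtain ⟨v, hv⟩ := hs
  simpa using (T.isTransOn_singleton v).card_le_trSizeOn (singleton_subset_iff.2 hv)

/-- Consecutive intervals of a transitive set. -/
theorem IsTransOn.exists_chunks {n : ℕ} {T : Tournament n} {R : Finset (Fin n)}
    (hR : T.IsTransOn R) {m : ℕ} (hm : 0 < m) (hmR : m ≤ #R) :
    ∃ ch : ℕ → Finset (Fin n), (∀ k < m, ch k ⊆ R ∧ #R ≤ 2 * m * #(ch k)) ∧
      ∀ k l, k < l → ∀ x ∈ ch k, ∀ y ∈ ch l, T.adj x y := by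
  set ρ : Fin n → ℕ := fun x => #{y ∈ R | T.adj y x} with hρ
  have hlt : ∀ x ∈ R, ∀ y ∈ R, T.adj x y → ρ x < ρ y := by
    intro x hx y hy hxy
    refine card_lt_card ((Finset.ssubset_iff_of_subset ?_).2
      ⟨x, mem_filter.2 ⟨hx, hxy⟩, fun h => T.not_adj_self x (mem_filter.1 h).2⟩)
    intro w hw
    rw [mem_filter] at hw ⊢
    exact ⟨hw.1, hR w hw.1 x hx y hy hw.2 hxy⟩
  have hadj : ∀ x ∈ R, ∀ y ∈ R, ρ x < ρ y → T.adj x y := by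
    intro x hx y hy hxy
    refine T.adj_of_not_adj (fun h => ?_) fun h => ?_
    · rw [h] at hxy
      exact lt_irrefl _ hxy
    · exact lt_asymm hxy (hlt y hy x hx h)
  have hinj : Set.InjOn ρ R := by
    intro x hx y hy hxy
    by_contra hne
    rcases T.total x y hne with h | h
    · exact (hlt x hx y hy h).ne hxy
    · exact (hlt y hy x hx h).ne hxy.symm
  have himg : R.image ρ = range #R := by
    refine eq_of_subset_of_card_le ?_ ?_
    · intro k hk
      obtain ⟨x, hx, rfl⟩ := mem_image.1 hk
      exact mem_range.2 (card_lt_card ((Finset.ssubset_iff_of_subset (filter_subset _ _)).2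
        ⟨x, hx, fun h => T.not_adj_self x (mem_filter.1 h).2⟩))
    · rw [card_image_of_injOn hinj, card_range]
  set s := #R / m with hs
  refine ⟨fun k => {x ∈ R | k * s ≤ ρ x ∧ ρ x < (k + 1) * s}, fun k hk => ?_, ?_⟩
  · refine ⟨filter_subset _ _, ?_⟩
    have hcard : #{x ∈ R | k * s ≤ ρ x ∧ ρ x < (k + 1) * s} = s := by
      rw [← card_image_of_injOn (hinj.mono (coe_subset.2 (filter_subset _ _)))]
      have : ({x ∈ R | k * s ≤ ρ x ∧ ρ x < (k + 1) * s}).image ρ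
          = Ico (k * s) ((k + 1) * s) := by
        ext a
        simp only [mem_image, mem_filter, mem_Ico]
        constructor
        · rintro ⟨x, hx, rfl⟩
          exact hx.2
        · intro ha
          have h1 : (k + 1) * s ≤ m * s := Nat.mul_le_mul_right _ hk
          have h2 : m * s ≤ #R := Nat.mul_div_le _ _
          have h3 : a ∈ R.image ρ := by
            rw [himg, mem_range]
            omega
          obtain ⟨x, hx, rfl⟩ := mem_image.1 h3
          exact ⟨x, ⟨hx, ha⟩, rfl⟩
      rw [this, Nat.card_Ico, add_mul, one_mul, Nat.add_sub_cancel_left]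
    rw [hcard]
    have h1 : #R < m * (s + 1) := by
      rw [mul_comm]
      exact Nat.lt_mul_of_div_lt (Nat.lt_succ_self _) hm
    have h2 : 1 ≤ s := (Nat.one_le_div_iff hm).2 hmR
    nlinarith
  · intro k l hkl x hx y hy
    rw [mem_filter] at hx hy
    have : (k + 1) * s ≤ l * s := Nat.mul_le_mul_right _ hkl
    exact hadj x hx.1 y hy.1 (by omega)

/-! ### Reduction to near-critical vertex sets -/

/-- Every subset of `U` that is large (up to the factor `C`) contains a transitive set almost as
large as the largest one in `U`. -/
def IsNearCritical {n : ℕ} (T : Tournament n) (C M : ℕ) (U : Finset (Fin n)) : Prop :=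
  2 ≤ #U ∧ ∀ s ⊆ U, #U ≤ C * #s →
    M * T.trSizeOn U < M * T.trSizeOn s + T.trSizeOn U

theorem exists_eps_forall_isNearCritical {C M : ℕ} (hC : 1 ≤ C) (hM : 2 ≤ M) :
    ∃ ε : ℝ, 0 < ε ∧ ∀ (n : ℕ) (T : Tournament n),
      (n : ℝ) ^ ε ≤ (T.trSize : ℝ) ∨ ∃ U, T.IsNearCritical C M U := by
  have hM' : (2 : ℝ) ≤ M := by exact_mod_cast hM
  have hC' : (1 : ℝ) ≤ C := by exact_mod_cast hC
  have hlogC : 0 ≤ Real.log C := Real.log_nonneg hC'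
  have hq : 1 < (M : ℝ) / (M - 1) := by
    rw [one_lt_div (by linarith)]
    linarith
  have hlq : 0 < Real.log ((M : ℝ) / (M - 1)) := Real.log_pos hq
  refine ⟨Real.log ((M : ℝ) / (M - 1)) / (Real.log C + 1), by positivity, fun n T => ?_⟩
  set ε := Real.log ((M : ℝ) / (M - 1)) / (Real.log C + 1) with hε
  have hε0 : 0 < ε := by positivity
  have hCε : ((M : ℝ) - 1) * (C : ℝ) ^ ε ≤ M := by
    have h1 : Real.log C * ε ≤ Real.log ((M : ℝ) / (M - 1)) := by
      rw [hε, ← mul_div_assoc, div_le_iff₀ (by linarith)]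
      nlinarith
    have h2 : (C : ℝ) ^ ε ≤ (M : ℝ) / (M - 1) := by
      rw [Real.rpow_def_of_pos (by linarith), ← Real.exp_log (by linarith : 0 < (M : ℝ) / (M - 1))]
      exact Real.exp_le_exp.2 h1
    rwa [le_div_iff₀ (by linarith), mul_comm] at h2
  by_contra! hcon
  obtain ⟨hlt, hU⟩ := hcon
  have hex : ∃ k, ∃ s : Finset (Fin n), #s = k ∧ (T.trSizeOn s : ℝ) < (#s : ℝ) ^ ε :=
    ⟨_, univ, rfl, by simpa [trSize] using hlt⟩
  obtain ⟨U, hUk, hUlt⟩ := Nat.find_spec hex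
  have hmin : ∀ s : Finset (Fin n), #s < #U → (#s : ℝ) ^ ε ≤ (T.trSizeOn s : ℝ) := by
    intro s hs
    by_contra! h
    exact Nat.find_min hex (hUk ▸ hs) ⟨s, rfl, h⟩
  have hUne : U.Nonempty := by
    rw [nonempty_iff_ne_empty]
    rintro rfl
    rw [card_empty, Nat.cast_zero, Real.zero_rpow hε0.ne'] at hUlt
    exact absurd hUlt (not_lt.2 (Nat.cast_nonneg _))
  have ht : 1 ≤ T.trSizeOn U := T.one_le_trSizeOn hUne
  refine hU U ⟨?_, fun s hs hsC => ?_⟩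
  · by_contra! h
    have h1 : #U = 1 := le_antisymm (by omega) hUne.card_pos
    rw [h1, Nat.cast_one, Real.one_rpow] at hUlt
    exact absurd hUlt (not_lt.2 (by exact_mod_cast ht))
  · rcases hs.eq_or_ssubset with rfl | hss
    · omega
    · have h1 := hmin s (card_lt_card hss)
      have h2 : (#U : ℝ) ^ ε ≤ (C : ℝ) ^ ε * (#s : ℝ) ^ ε := by
        rw [← Real.mul_rpow (by positivity) (by positivity)]
        exact Real.rpow_le_rpow (by positivity) (by exact_mod_cast hsC) hε0.le
      have h3 : (0 : ℝ) ≤ (C : ℝ) ^ ε := by positivity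
      have h4 : (T.trSizeOn U : ℝ) < (C : ℝ) ^ ε * T.trSizeOn s :=
        hUlt.trans_le (h2.trans (mul_le_mul_of_nonneg_left h1 h3))
      have h5 : ((M : ℝ) - 1) * T.trSizeOn U < ((M : ℝ) - 1) * ((C : ℝ) ^ ε * T.trSizeOn s) :=
        mul_lt_mul_of_pos_left h4 (by linarith)
      have h6 : ((M : ℝ) - 1) * (C : ℝ) ^ ε * T.trSizeOn s ≤ M * T.trSizeOn s :=
        mul_le_mul_of_nonneg_right hCε (by positivity)
      have h7 : (M : ℝ) * T.trSizeOn U < M * T.trSizeOn s + T.trSizeOn U := by linarith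
      exact_mod_cast h7

theorem IsNearCritical.lt_trSizeOn {n : ℕ} {T : Tournament n} {C M : ℕ} {U : Finset (Fin n)}
    (hU : T.IsNearCritical C M U) (hC : 4 ≤ C) : M < T.trSizeOn U := by
  obtain ⟨hU2, hcrit⟩ := hU
  obtain ⟨v, hv⟩ : U.Nonempty := card_pos.1 (by omega)
  suffices h : ∃ s ⊆ U, #U ≤ 4 * #s ∧ T.trSizeOn s + 1 ≤ T.trSizeOn U by
    obtain ⟨s, hs, hcard, htr⟩ := h
    have := hcrit s hs (hcard.trans (Nat.mul_le_mul_right _ hC))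
    nlinarith
  have hsplit : #{x ∈ U.erase v | T.adj v x} + #{x ∈ U.erase v | ¬ T.adj v x} + 1 = #U := by
    rw [card_filter_add_card_filter_not, card_erase_add_one hv]
  rcases le_total #{x ∈ U.erase v | T.adj v x} #{x ∈ U.erase v | ¬ T.adj v x} with h | h
  · refine ⟨{x ∈ U.erase v | ¬ T.adj v x}, (filter_subset _ _).trans (erase_subset _ _),
      by omega, ?_⟩
    obtain ⟨S, hS, htr, hcard⟩ := T.exists_isTransOn_card_eq {x ∈ U.erase v | ¬ T.adj v x}
    have hvS : v ∉ S := fun h => (mem_erase.1 (mem_filter.1 (hS h)).1).1 rfl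
    rw [← hcard, ← card_singleton v, ← card_union_of_disjoint (disjoint_singleton_right.2 hvS)]
    refine (htr.union (T.isTransOn_singleton v) ?_).card_le_trSizeOn
      (union_subset (hS.trans ((filter_subset _ _).trans (erase_subset _ _)))
        (singleton_subset_iff.2 hv))
    intro a ha b hb
    rw [mem_singleton.1 hb]
    have := mem_filter.1 (hS ha)
    exact T.adj_of_not_adj (mem_erase.1 this.1).1 this.2
  · refine ⟨{x ∈ U.erase v | T.adj v x}, (filter_subset _ _).trans (erase_subset _ _),
      by omega, ?_⟩
    obtain ⟨S, hS, htr, hcard⟩ := T.exists_isTransOn_card_eq {x ∈ U.erase v | T.adj v x}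
    have hvS : v ∉ S := fun h => (mem_erase.1 (mem_filter.1 (hS h)).1).1 rfl
    rw [← hcard, add_comm, ← card_singleton v,
      ← card_union_of_disjoint (disjoint_singleton_left.2 hvS)]
    refine ((T.isTransOn_singleton v).union htr ?_).card_le_trSizeOn
      (union_subset (singleton_subset_iff.2 hv)
        (hS.trans ((filter_subset _ _).trans (erase_subset _ _))))
    intro a ha b hb
    rw [mem_singleton.1 ha]
    exact (mem_filter.1 (hS hb)).2

theorem exists_card_le_mul_card {α ι : Type*} {Y : Finset α} (hY : Y.Nonempty) {J : Finset ι}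
    {m : ℕ} (hJ : #J ≤ m) (F : ι → Finset α) (hF : ∀ y ∈ Y, ∃ j ∈ J, y ∈ F j) :
    ∃ j ∈ J, #Y ≤ m * #(F j) := by
  by_contra! h
  have hJne : J.Nonempty := by
    obtain ⟨y, hy⟩ := hY
    obtain ⟨j, hj, -⟩ := hF y hy
    exact ⟨j, hj⟩
  have h1 : #Y ≤ ∑ j ∈ J, #(F j) := 
    (card_le_card fun y hy => mem_biUnion.2 (hF y hy)).trans card_biUnion_le
  have h2 : ∑ j ∈ J, m * #(F j) < ∑ _j ∈ J, #Y := sum_lt_sum_of_nonempty hJne h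
  rw [← mul_sum, sum_const, smul_eq_mul] at h2
  have h3 : #J * #Y ≤ m * #Y := Nat.mul_le_mul_right _ hJ
  have h4 := Nat.mul_le_mul_left m h1
  omega

/-- If one direction is missing between a transitive set and `Y`, the union is almost transitive. -/
theorem card_add_trSizeOn_le {n : ℕ} {T : Tournament n} {U X Y : Finset (Fin n)} (hX : X ⊆ U)
    (hXt : T.IsTransOn X) (hY : Y ⊆ U)
    (h : (∀ x ∈ X, ∀ y ∈ Y, ¬ T.adj x y) ∨ ∀ x ∈ X, ∀ y ∈ Y, ¬ T.adj y x) :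
    #X + T.trSizeOn Y ≤ T.trSizeOn U + 1 := by
  obtain ⟨S, hS, hSt, hcard⟩ := T.exists_isTransOn_card_eq Y
  have hinter : #(X ∩ S) ≤ 1 := by
    refine card_le_one.2 fun a ha b hb => ?_
    rw [mem_inter] at ha hb
    by_contra hne
    rcases h with h | h
    · exact h a ha.1 b (hS hb.2) (T.adj_of_not_adj hne (h b hb.1 a (hS ha.2)))
    · exact h b hb.1 a (hS ha.2) (T.adj_of_not_adj hne (h a ha.1 b (hS hb.2)))
  have hsub : X \ S ∪ S ⊆ U := union_subset (sdiff_subset.trans hX) (hS.trans hY)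
  have htrans : T.IsTransOn (X \ S ∪ S) := by
    have hne : ∀ a ∈ X \ S, ∀ b ∈ S, a ≠ b := by
      rintro a ha b hb rfl
      exact (mem_sdiff.1 ha).2 hb
    rcases h with h | h
    · rw [union_comm]
      exact hSt.union (hXt.mono sdiff_subset) fun a ha b hb =>
        T.adj_of_not_adj (hne b hb a ha).symm (h b (mem_sdiff.1 hb).1 a (hS ha))
    · exact (hXt.mono sdiff_subset).union hSt fun a ha b hb =>
        T.adj_of_not_adj (hne a ha b hb) (h a (mem_sdiff.1 ha).1 b (hS hb))
  have h1 := htrans.card_le_trSizeOn hsub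
  rw [card_union_of_disjoint sdiff_disjoint] at h1
  have h2 := card_sdiff_add_card_inter X S
  omega

/-- A large set has a vertex with prescribed-direction neighbours in boundedly many given
transitive sets. -/
theorem IsNearCritical.exists_forall_exists_adj {n : ℕ} {T : Tournament n} {C M C' M' m : ℕ}
    {U : Finset (Fin n)} (hU : T.IsNearCritical C M U) (hC : 4 ≤ C) (hC' : m * C' ≤ C)
    (hM' : 2 * M' ≤ M) {ι : Type*} {J : Finset ι} (hJ : #J ≤ m) (X : ι → Finset (Fin n))
    (d : ι → Prop)
    (hX : ∀ j ∈ J, X j ⊆ U ∧ T.IsTransOn (X j) ∧ T.trSizeOn U ≤ M' * #(X j))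
    {Y : Finset (Fin n)} (hY : Y ⊆ U) (hYc : #U ≤ C' * #Y) :
    ∃ y ∈ Y, ∀ j ∈ J, ∃ x ∈ X j, (d j → T.adj y x) ∧ (¬ d j → T.adj x y) := by
  have ht := hU.lt_trSizeOn hC
  obtain ⟨hU2, hcrit⟩ := hU
  by_contra! hcon
  have hYne : Y.Nonempty := by
    rw [← card_pos]
    by_contra! h
    rw [Nat.le_zero.1 h] at hYc
    omega
  obtain ⟨j, hj, hcard⟩ := exists_card_le_mul_card hYne hJ
    (fun j => {y ∈ Y | ∀ x ∈ X j, (d j → T.adj y x) → ¬ d j ∧ ¬ T.adj x y}) (by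
      intro y hy
      obtain ⟨j, hj, h⟩ := hcon y hy
      exact ⟨j, hj, mem_filter.2 ⟨hy, h⟩⟩)
  set Z := {y ∈ Y | ∀ x ∈ X j, (d j → T.adj y x) → ¬ d j ∧ ¬ T.adj x y} with hZ
  have hZU : Z ⊆ U := (filter_subset _ _).trans hY
  have hZc : #U ≤ C * #Z := by
    calc #U ≤ C' * #Y := hYc
      _ ≤ C' * (m * #Z) := Nat.mul_le_mul_left _ hcard
      _ = m * C' * #Z := by ring
      _ ≤ C * #Z := Nat.mul_le_mul_right _ hC'
  obtain ⟨hXU, hXt, hXc⟩ := hX j hj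
  have hle : #(X j) + T.trSizeOn Z ≤ T.trSizeOn U + 1 := by
    refine card_add_trSizeOn_le hXU hXt hZU ?_
    by_cases hd : d j
    · exact Or.inr fun x hx y hy h => ((mem_filter.1 hy).2 x hx fun _ => h).1 hd
    · exact Or.inl fun x hx y hy => ((mem_filter.1 hy).2 x hx fun h => absurd h hd).2
  have hlt := hcrit Z hZU hZc
  have h1 : M' * 2 ≤ M := by omega
  rcases Nat.lt_or_ge #(X j) 2 with h2 | h2
  · have : M' * #(X j) ≤ M' * 1 := Nat.mul_le_mul_left _ (by omega)
    omega
  · obtain ⟨x, hx⟩ := Nat.exists_eq_add_of_le h2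
    rw [hx] at hle hXc
    have h3 : T.trSizeOn Z + (x + 1) ≤ T.trSizeOn U := by omega
    have h4 : M * (T.trSizeOn Z + (x + 1)) ≤ M * T.trSizeOn U := Nat.mul_le_mul_left _ h3
    have h5 : M' * 2 * (x + 1) ≤ M * (x + 1) := Nat.mul_le_mul_right _ h1
    nlinarith

/-! ### Sparse and smooth families -/

/-- The number of pairs in `A × B` not joined by an arc from `A` to `B`. -/
noncomputable def bad {n : ℕ} (T : Tournament n) (A B : Finset (Fin n)) : ℕ :=
  ∑ x ∈ A, #{y ∈ B | ¬ T.adj x y}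

theorem bad_eq_sum_right {n : ℕ} (T : Tournament n) (A B : Finset (Fin n)) :
    T.bad A B = ∑ y ∈ B, #{x ∈ A | ¬ T.adj x y} :=
  sum_card_bipartiteAbove_eq_sum_card_bipartiteBelow _

theorem bad_mono {n : ℕ} (T : Tournament n) {A A' B B' : Finset (Fin n)} (hA : A ⊆ A')
    (hB : B ⊆ B') : T.bad A B ≤ T.bad A' B' :=
  (sum_le_sum fun _ _ => card_le_card (filter_subset_filter _ hB)).trans
    (sum_le_sum_of_subset hA)

theorem bad_of_subset {n : ℕ} (T : Tournament n) {κ c d : ℕ} {A A' B B' : Finset (Fin n)}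
    (hA : A' ⊆ A) (hB : B' ⊆ B) (hAc : #A ≤ c * #A') (hBc : #B ≤ d * #B')
    (h : κ * (c * d) * T.bad A B ≤ #A * #B) : κ * T.bad A' B' ≤ #A' * #B' := by
  rcases Nat.eq_zero_or_pos (c * d) with h0 | hpos
  · have h1 : #A' * #B' ≤ 0 := by
      calc #A' * #B' ≤ #A * #B := Nat.mul_le_mul (card_le_card hA) (card_le_card hB)
        _ ≤ (c * #A') * (d * #B') := Nat.mul_le_mul hAc hBc
        _ = c * d * (#A' * #B') := by ring
        _ = 0 := by rw [h0, zero_mul]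
    have h2 : T.bad A' B' = 0 := by
      rcases Nat.mul_eq_zero.1 (Nat.le_zero.1 h1) with h | h
      · simp [bad, card_eq_zero.1 h]
      · simp [bad, card_eq_zero.1 h]
    simp [h2]
  · refine Nat.le_of_mul_le_mul_left ?_ hpos
    calc c * d * (κ * T.bad A' B') ≤ c * d * (κ * T.bad A B) := by
          gcongr
          exact T.bad_mono hA hB
      _ = κ * (c * d) * T.bad A B := by ring
      _ ≤ (c * #A') * (d * #B') := h.trans (Nat.mul_le_mul hAc hBc)
      _ = c * d * (#A' * #B') := by ring

/-- The arc between `x` and `y` is forward when `x` and `y` have ranks `r i` and `r j`. -/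
def Fwd {n : ℕ} (T : Tournament n) {ι : Type*} (r : ι → ℕ) (i j : ι) (x y : Fin n) : Prop :=
  (r i < r j → T.adj x y) ∧ (r j < r i → T.adj y x)

/-- The number of vertices of `B` with index `j` joined by a non-forward arc to the vertex `x`
with index `i`. -/
noncomputable def badAt {n : ℕ} (T : Tournament n) {ι : Type*} (r : ι → ℕ) (i j : ι)
    (B : Finset (Fin n)) (x : Fin n) : ℕ :=
  #{y ∈ B | ¬ T.Fwd r i j x y}

/-- All pairs of sets of the family have few non-forward pairs. -/
def SparseFam {n : ℕ} (T : Tournament n) {ι : Type*} (r : ι → ℕ) (κ : ℕ)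
    (V : ι → Finset (Fin n)) : Prop :=
  ∀ i j, r i < r j → κ * T.bad (V i) (V j) ≤ #(V i) * #(V j)

theorem badAt_mono {n : ℕ} (T : Tournament n) {ι : Type*} (r : ι → ℕ) (i j : ι)
    {B B' : Finset (Fin n)} (hB : B ⊆ B') (x : Fin n) :
    T.badAt r i j B x ≤ T.badAt r i j B' x :=
  card_le_card (filter_subset_filter _ hB)

theorem badAt_of_lt {n : ℕ} (T : Tournament n) {ι : Type*} {r : ι → ℕ} {i j : ι}
    (h : r i < r j) (B : Finset (Fin n)) (x : Fin n) :
    T.badAt r i j B x = #{y ∈ B | ¬ T.adj x y} := by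
  simp [badAt, Fwd, h, h.not_gt]

theorem badAt_of_gt {n : ℕ} (T : Tournament n) {ι : Type*} {r : ι → ℕ} {i j : ι}
    (h : r j < r i) (B : Finset (Fin n)) (x : Fin n) :
    T.badAt r i j B x = #{y ∈ B | ¬ T.adj y x} := by
  simp [badAt, Fwd, h, h.not_gt]

theorem badAt_of_eq {n : ℕ} (T : Tournament n) {ι : Type*} {r : ι → ℕ} {i j : ι}
    (h : r i = r j) (B : Finset (Fin n)) (x : Fin n) : T.badAt r i j B x = 0 := by
  simp [badAt, Fwd, h]

theorem SparseFam.sum_badAt_le {n : ℕ} {T : Tournament n} {ι : Type*} {r : ι → ℕ} {κ : ℕ}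
    {V : ι → Finset (Fin n)} (hV : T.SparseFam r κ V) (i j : ι) :
    κ * ∑ x ∈ V i, T.badAt r i j (V j) x ≤ #(V i) * #(V j) := by
  rcases lt_trichotomy (r i) (r j) with h | h | h
  · simpa only [T.badAt_of_lt h, bad] using hV i j h
  · simp [T.badAt_of_eq h]
  · have := hV j i h
    rw [bad_eq_sum_right, mul_comm #(V j)] at this
    simpa only [T.badAt_of_gt h] using this

/-- Markov's inequality for finitely many weights simultaneously. -/
theorem exists_subset_forall_mul_le {α ι : Type*} (A : Finset α) (J : Finset ι) {k κ : ℕ}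
    (hJ : #J ≤ k) (w : ι → α → ℕ) (b : ι → ℕ)
    (h : ∀ j ∈ J, 2 * k * κ * ∑ x ∈ A, w j x ≤ #A * b j) :
    ∃ A' ⊆ A, #A ≤ 2 * #A' ∧ ∀ x ∈ A', ∀ j ∈ J, κ * w j x ≤ b j := by
  refine ⟨{x ∈ A | ∀ j ∈ J, κ * w j x ≤ b j}, filter_subset _ _, ?_,
    fun x hx => (mem_filter.1 hx).2⟩
  have hsplit := card_filter_add_card_filter_not (s := A) (fun x => ∀ j ∈ J, κ * w j x ≤ b j)
  rcases Nat.eq_zero_or_pos #{x ∈ A | ¬ ∀ j ∈ J, κ * w j x ≤ b j} with h0 | hpos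
  · omega
  obtain ⟨j, hj, hcard⟩ := exists_card_le_mul_card (card_pos.1 hpos) hJ
    (fun j => {x ∈ A | b j < κ * w j x}) (by
      intro x hx
      rw [mem_filter] at hx
      have := hx.2
      push Not at this
      obtain ⟨j, hj, hlt⟩ := this
      exact ⟨j, hj, mem_filter.2 ⟨hx.1, hlt⟩⟩)
  have h1 : #{x ∈ A | b j < κ * w j x} * (b j + 1) ≤ κ * ∑ x ∈ A, w j x := by
    calc #{x ∈ A | b j < κ * w j x} * (b j + 1)
        = ∑ _x ∈ A with b j < κ * w j _x, (b j + 1) := by rw [sum_const, smul_eq_mul]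
      _ ≤ ∑ x ∈ A with b j < κ * w j x, κ * w j x :=
          sum_le_sum fun x hx => (mem_filter.1 hx).2
      _ ≤ ∑ x ∈ A, κ * w j x := sum_le_sum_of_subset (filter_subset _ _)
      _ = κ * ∑ x ∈ A, w j x := by rw [mul_sum]
  have h2 : 2 * k * #{x ∈ A | b j < κ * w j x} * (b j + 1) ≤ #A * (b j + 1) := by
    calc 2 * k * #{x ∈ A | b j < κ * w j x} * (b j + 1)
        = 2 * k * (#{x ∈ A | b j < κ * w j x} * (b j + 1)) := by ring
      _ ≤ 2 * k * (κ * ∑ x ∈ A, w j x) := Nat.mul_le_mul_left _ h1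
      _ = 2 * k * κ * ∑ x ∈ A, w j x := by ring
      _ ≤ #A * b j := h j hj
      _ ≤ #A * (b j + 1) := Nat.mul_le_mul_left _ (Nat.le_succ _)
  have h3 : 2 * k * #{x ∈ A | b j < κ * w j x} ≤ #A :=
    Nat.le_of_mul_le_mul_right h2 (Nat.succ_pos _)
  have h4 : 2 * k * #{x ∈ A | b j < κ * w j x} = 2 * (k * #{x ∈ A | b j < κ * w j x}) := by ring
  omega

theorem SparseFam.of_le {n : ℕ} {T : Tournament n} {ι : Type*} {r : ι → ℕ} {κ κ' : ℕ}
    {V : ι → Finset (Fin n)} (hV : T.SparseFam r κ' V) (h : κ ≤ κ') : T.SparseFam r κ V :=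
  fun i j hij => (Nat.mul_le_mul_right _ h).trans (hV i j hij)

theorem SparseFam.exists_smooth {n : ℕ} {T : Tournament n} {ι : Type*} [Fintype ι] {r : ι → ℕ}
    {κ : ℕ} {V : ι → Finset (Fin n)} (hV : T.SparseFam r (4 * Fintype.card ι * κ) V) :
    ∃ V' : ι → Finset (Fin n), (∀ i, V' i ⊆ V i ∧ #(V i) ≤ 2 * #(V' i)) ∧
      ∀ i j, ∀ x ∈ V' i, κ * T.badAt r i j (V' j) x ≤ #(V' j) := by
  have hhalf : ∀ i, ∃ A' ⊆ V i, #(V i) ≤ 2 * #A' ∧ ∀ x ∈ A', ∀ j ∈ (univ : Finset ι),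
      (2 * κ) * T.badAt r i j (V j) x ≤ #(V j) := by
    intro i
    refine exists_subset_forall_mul_le (V i) univ (card_univ (α := ι)).le _ _ fun j _ => ?_
    calc 2 * Fintype.card ι * (2 * κ) * ∑ x ∈ V i, T.badAt r i j (V j) x
        = 4 * Fintype.card ι * κ * ∑ x ∈ V i, T.badAt r i j (V j) x := by ring
      _ ≤ _ := hV.sum_badAt_le i j
  choose V' hV' hcard hbad using hhalf
  refine ⟨V', fun i => ⟨hV' i, hcard i⟩, fun i j x hx => ?_⟩
  have h1 := hbad i x hx j (mem_univ j)
  have h2 := hcard j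
  have h4 := Nat.mul_le_mul_left κ (T.badAt_mono r i j (hV' j) x)
  rw [mul_assoc] at h1
  omega

theorem SparseFam.exists_forall_update {n : ℕ} {T : Tournament n} {ι : Type*} [Fintype ι]
    {r : ι → ℕ} {κ : ℕ} {V : ι → Finset (Fin n)}
    (hV : T.SparseFam r (2 * Fintype.card ι * κ) V) (i : ι) :
    ∃ L ⊆ V i, #(V i) ≤ 2 * #L ∧ ∀ R ⊆ L, T.SparseFam r κ (Function.update V i R) := by
  obtain ⟨L, hL, hcard, hbad⟩ := exists_subset_forall_mul_le (V i) univ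
    (card_univ (α := ι)).le (fun j => T.badAt r i j (V j)) (fun j => #(V j))
    fun j _ => hV.sum_badAt_le i j
  refine ⟨L, hL, hcard, fun R hR => ?_⟩
  have hsum : ∀ j, κ * ∑ x ∈ R, T.badAt r i j (V j) x ≤ #R * #(V j) := by
    intro j
    rw [mul_sum, ← smul_eq_mul #R]
    exact sum_le_card_nsmul _ _ _ fun x hx => hbad x (hR hx) j (mem_univ j)
  intro a b hab
  by_cases ha : a = i
  · subst ha
    have hb : b ≠ a := by
      rintro rfl
      exact lt_irrefl _ hab
    rw [Function.update_self, Function.update_of_ne hb]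
    simpa only [T.badAt_of_lt hab, bad] using hsum b
  · rw [Function.update_of_ne ha]
    by_cases hb : b = i
    · subst hb
      rw [Function.update_self, bad_eq_sum_right, mul_comm #(V a)]
      simpa only [T.badAt_of_gt hab] using hsum a
    · rw [Function.update_of_ne hb]
      refine (Nat.mul_le_mul_right _ ?_).trans (hV a b hab)
      have : 0 < Fintype.card ι := Fintype.card_pos_iff.2 ⟨i⟩
      exact Nat.le_mul_of_pos_left _ (by omega)

/-- In a sparse family, selected sets may be replaced by suitable subsets. -/
theorem SparseFam.exists_replace {n : ℕ} {T : Tournament n} {ι : Type*} [Fintype ι] {r : ι → ℕ}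
    (P : Finset (Fin n) → Prop) {κ : ℕ} (s : Finset ι) :
    ∀ V : ι → Finset (Fin n), T.SparseFam r ((2 * Fintype.card ι) ^ #s * κ) V →
      (∀ i ∈ s, ∀ L ⊆ V i, #(V i) ≤ 2 * #L → ∃ R ⊆ L, P R) →
      ∃ V' : ι → Finset (Fin n), (∀ i, V' i ⊆ V i) ∧ (∀ i ∈ s, P (V' i)) ∧
        (∀ i ∉ s, V' i = V i) ∧ T.SparseFam r κ V' := by
  induction s using Finset.induction_on with
  | empty =>
    intro V hV _
    refine ⟨V, fun _ => subset_rfl, fun i hi => absurd hi (notMem_empty i), fun _ _ => rfl, ?_⟩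
    simpa using hV
  | insert i s hi ih =>
    intro V hV hP
    rw [card_insert_of_notMem hi, pow_succ', mul_assoc (2 * Fintype.card ι)] at hV
    obtain ⟨L, hL, hLc, hupd⟩ := hV.exists_forall_update i
    obtain ⟨R, hR, hPR⟩ := hP i (mem_insert_self i s) L hL hLc
    have hne : ∀ j ∈ s, j ≠ i := by
      rintro j hj rfl
      exact hi hj
    obtain ⟨V', h1, h2, h3, h4⟩ := ih _ (hupd R hR) (by
      intro j hj
      rw [Function.update_of_ne (hne j hj)]
      exact hP j (mem_insert_of_mem hj))
    have hi' : V' i = R := by rw [h3 i hi, Function.update_self]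
    refine ⟨V', fun j => ?_, fun j hj => ?_, fun j hj => ?_, h4⟩
    · by_cases hj : j = i
      · subst hj
        rw [hi']
        exact hR.trans hL
      · have := h1 j
        rwa [Function.update_of_ne hj] at this
    · rcases mem_insert.1 hj with rfl | hj
      · rwa [hi']
      · exact h2 j hj
    · rw [mem_insert, not_or] at hj
      rw [h3 j hj.2, Function.update_of_ne hj.1]

/-! ### Greedy embedding -/

theorem contains_of_forall_adj {m n : ℕ} {H : Tournament m} {T : Tournament n}
    (f : Fin m → Fin n) (hadj : ∀ u v, H.adj u v → T.adj (f u) (f v)) : T.Contains H := by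
  have hinj : Function.Injective f := by
    intro u v huv
    by_contra hne
    rcases H.total u v hne with h | h
    · exact T.ne_of_adj (hadj u v h) huv
    · exact T.ne_of_adj (hadj v u h) huv.symm
  refine ⟨⟨f, hinj⟩, fun u v => ⟨hadj u v, fun h => ?_⟩⟩
  refine H.adj_of_not_adj (fun he => ?_) fun h' => T.asymm _ _ h (hadj v u h')
  subst he
  exact T.not_adj_self _ h

theorem exists_label {α ι : Type*} (Q : ι → Finset α) (ctr : ι → α) (hc : ∀ i, ctr i ∈ Q i)
    (hQ : ∀ i j, i ≠ j → Disjoint (Q i) (Q j)) :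
    ∃ p : α → α, (∀ i, ∀ u ∈ Q i, ∀ v ∈ Q i, p u = p v) ∧
      ∀ a, (∃ i, ∀ v, p v = a ↔ v ∈ Q i) ∨ ∀ v, p v = a → v = a := by
  have huniq : ∀ i j v, v ∈ Q i → v ∈ Q j → i = j := fun i j v hi hj => by
    by_contra hne
    exact disjoint_left.1 (hQ i j hne) hi hj
  set p : α → α := fun v => if h : ∃ i, v ∈ Q i then ctr h.choose else v with hp
  have h1 : ∀ i v, v ∈ Q i → p v = ctr i := by
    intro i v hv
    have h : ∃ i, v ∈ Q i := ⟨i, hv⟩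
    rw [hp]
    dsimp only
    rw [dif_pos h, huniq _ _ _ h.choose_spec hv]
  have h2 : ∀ v, (¬ ∃ i, v ∈ Q i) → p v = v := fun v hv => dif_neg hv
  refine ⟨p, fun i u hu v hv => by rw [h1 i u hu, h1 i v hv], fun a => ?_⟩
  by_cases ha : ∃ i, a = ctr i
  · obtain ⟨i, rfl⟩ := ha
    refine Or.inl ⟨i, fun v => ⟨fun h => ?_, h1 i v⟩⟩
    by_cases hv : ∃ j, v ∈ Q j
    · obtain ⟨j, hj⟩ := hv
      rw [h1 j v hj] at h
      rwa [huniq i j (ctr i) (hc i) (h ▸ hc j)]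
    · rw [h2 v hv] at h
      rw [h]
      exact hc i
  · refine Or.inr fun v hv => ?_
    by_cases hv' : ∃ j, v ∈ Q j
    · obtain ⟨j, hj⟩ := hv'
      exact absurd ⟨j, by rw [← hv, h1 j v hj]⟩ ha
    · rw [← hv, h2 v hv']

/-- If the backward arcs of `H` lie inside disjoint pieces, and each piece can be embedded in all
large subfamilies of a smooth family, then `H` can be embedded. -/
theorem contains_of_smooth {m n : ℕ} (H : Tournament m) (T : Tournament n) {r : Fin m → ℕ}
    (hr : Function.Injective r) {ι : Type*} (Q : ι → Finset (Fin m)) (ctr : ι → Fin m)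
    (hc : ∀ i, ctr i ∈ Q i) (hQ : ∀ i j, i ≠ j → Disjoint (Q i) (Q j))
    (hback : ∀ u v, H.adj u v → r v < r u → ∃ i, u ∈ Q i ∧ v ∈ Q i)
    (V : Fin m → Finset (Fin n)) (hne : ∀ v, (V v).Nonempty)
    (hV : ∀ i j, ∀ x ∈ V i, 2 * m * T.badAt r i j (V j) x ≤ #(V j))
    (hloc : ∀ i, ∀ W : Fin m → Finset (Fin n),
      (∀ v ∈ Q i, W v ⊆ V v ∧ #(V v) ≤ 2 * #(W v)) →
      ∃ f : Fin m → Fin n, (∀ v ∈ Q i, f v ∈ W v) ∧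
        ∀ u ∈ Q i, ∀ v ∈ Q i, H.adj u v → T.adj (f u) (f v)) :
    T.Contains H := by
  obtain ⟨p, hpQ, hp⟩ := exists_label Q ctr hc hQ
  choose f₀ hf₀ using fun v => hne v
  have hpiece : ∀ i, ∀ W : Fin m → Finset (Fin n),
      (∀ v, p v = i → W v ⊆ V v ∧ #(V v) ≤ 2 * #(W v)) →
      ∃ f : Fin m → Fin n, (∀ v, p v = i → f v ∈ W v) ∧
        ∀ u v, p u = i → p v = i → H.adj u v → T.adj (f u) (f v) := by
    intro a W hW
    rcases hp a with ⟨i, hi⟩ | ha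
    · obtain ⟨f, hf1, hf2⟩ := hloc i W fun v hv => hW v ((hi v).2 hv)
      exact ⟨f, fun v hv => hf1 v ((hi v).1 hv),
        fun u v hu hv => hf2 u ((hi u).1 hu) v ((hi v).1 hv)⟩
    · have hWne : ∀ v, p v = a → (W v).Nonempty := by
        intro v hv
        have h1 := (hW v hv).2
        have h2 := (hne v).card_pos
        exact card_pos.1 (by omega)
      refine ⟨fun v => if h : (W v).Nonempty then h.choose else f₀ v, fun v hv => ?_, ?_⟩
      · dsimp only
        rw [dif_pos (hWne v hv)]
        exact (hWne v hv).choose_spec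
      · intro u v hu hv h
        rw [ha u hu, ha v hv] at h
        exact absurd h (H.not_adj_self a)
  have key : ∀ s : Finset (Fin m), ∃ f : Fin m → Fin n, (∀ v, p v ∈ s → f v ∈ V v) ∧
      ∀ u v, p u ∈ s → p v ∈ s → H.adj u v → T.adj (f u) (f v) := by
    intro s
    induction s using Finset.induction_on with
    | empty =>
      exact ⟨f₀, fun v hv => absurd hv (notMem_empty _), fun u v hu => absurd hu (notMem_empty _)⟩
    | insert a s ha ih =>
      obtain ⟨f, hf1, hf2⟩ := ih
      obtain ⟨g, hg1, hg2⟩ := hpiece a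
        (fun v => {y ∈ V v | ∀ u, p u ∈ s → T.Fwd r u v (f u) y}) (by
          intro v _
          refine ⟨filter_subset _ _, ?_⟩
          have hsplit := card_filter_add_card_filter_not (s := V v)
            (fun y => ∀ u, p u ∈ s → T.Fwd r u v (f u) y)
          rcases Nat.eq_zero_or_pos #{y ∈ V v | ¬ ∀ u, p u ∈ s → T.Fwd r u v (f u) y}
            with h0 | hpos
          · omega
          obtain ⟨u, hu, hcard⟩ := exists_card_le_mul_card (card_pos.1 hpos)
            (J := univ.filter fun u => p u ∈ s) (m := m)
            ((card_filter_le _ _).trans (by simp))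
            (fun u => {y ∈ V v | ¬ T.Fwd r u v (f u) y}) (by
              intro y hy
              rw [mem_filter] at hy
              have := hy.2
              push Not at this
              obtain ⟨u, hu, hlt⟩ := this
              exact ⟨u, mem_filter.2 ⟨mem_univ u, hu⟩, mem_filter.2 ⟨hy.1, hlt⟩⟩)
          have h1 := hV u v (f u) (hf1 u (mem_filter.1 hu).2)
          rw [mul_assoc] at h1
          change 2 * (m * #{y ∈ V v | ¬ T.Fwd r u v (f u) y}) ≤ _ at h1
          omega)
      refine ⟨fun v => if p v = a then g v else f v, fun v hv => ?_, fun u v hu hv huv => ?_⟩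
      · dsimp only
        by_cases hva : p v = a
        · rw [if_pos hva]
          exact (mem_filter.1 (hg1 v hva)).1
        · rw [if_neg hva]
          exact hf1 v ((mem_insert.1 hv).resolve_left hva)
      · have hnb : p u ≠ p v → r u < r v := by
          intro hne
          refine lt_of_le_of_ne (not_lt.1 fun hlt => ?_) fun h => hne (by rw [hr h])
          obtain ⟨i, hui, hvi⟩ := hback u v huv hlt
          exact hne (hpQ i u hui v hvi)
        dsimp only
        by_cases hua : p u = a <;> by_cases hva : p v = a
        · rw [if_pos hua, if_pos hva]
          exact hg2 u v hua hva huv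
        · rw [if_pos hua, if_neg hva]
          exact ((mem_filter.1 (hg1 u hua)).2 v ((mem_insert.1 hv).resolve_left hva)).2
            (hnb (by rw [hua]; exact Ne.symm hva))
        · rw [if_neg hua, if_pos hva]
          exact ((mem_filter.1 (hg1 v hva)).2 u ((mem_insert.1 hu).resolve_left hua)).1
            (hnb (by rw [hva]; exact hua))
        · rw [if_neg hua, if_neg hva]
          exact hf2 u v ((mem_insert.1 hu).resolve_left hua)
            ((mem_insert.1 hv).resolve_left hva) huv
  obtain ⟨f, -, hf⟩ := key univ
  exact contains_of_forall_adj f fun u v => hf u v (mem_univ _) (mem_univ _)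

/-! ### Sparse families in tournaments excluding a fixed tournament -/

theorem exists_embedding_or_sparse {h n : ℕ} (H : Tournament h) (T : Tournament n) {κ : ℕ}
    (hκ : 1 ≤ κ) {U : Finset (Fin n)} (hU : U.Nonempty) (J : Finset (Fin h)) :
    ∀ (D : ℕ) (V : Fin h → Finset (Fin n)), (∀ j ∈ J, V j ⊆ U ∧ #U ≤ D * #(V j)) →
    (∃ f : Fin h → Fin n, (∀ j ∈ J, f j ∈ V j) ∧
      ∀ u ∈ J, ∀ v ∈ J, H.adj u v → T.adj (f u) (f v)) ∨
    ∃ A ⊆ U, ∃ B ⊆ U, #U ≤ D * κ ^ #J * h * #A ∧ #U ≤ D * κ ^ #J * h * #B ∧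
      κ * ∑ x ∈ A, #{y ∈ B | T.adj y x} ≤ #A * #B := by
  induction J using Finset.induction_on with
  | empty =>
    intro D V _
    obtain ⟨x, -⟩ := hU
    exact Or.inl ⟨fun _ => x, fun j hj => absurd hj (notMem_empty j),
      fun u hu => absurd hu (notMem_empty u)⟩
  | insert j₀ J hj₀ ih =>
    intro D V hV
    set N : Fin h → Fin n → Finset (Fin n) := fun j x =>
      {y ∈ V j | (H.adj j₀ j → T.adj x y) ∧ (H.adj j j₀ → T.adj y x)} with hN
    have hV₀ := hV j₀ (mem_insert_self _ _)
    by_cases hx : ∃ x₀ ∈ V j₀, ∀ j ∈ J, #(V j) ≤ κ * #(N j x₀)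
    · obtain ⟨x₀, hx₀, hx⟩ := hx
      rcases ih (D * κ) (fun j => N j x₀) (fun j hj => ⟨(filter_subset _ _).trans
        (hV j (mem_insert_of_mem hj)).1, (hV j (mem_insert_of_mem hj)).2.trans (by
          rw [mul_assoc]
          exact Nat.mul_le_mul_left _ (hx j hj))⟩) with ⟨f, hf1, hf2⟩ | ⟨A, hA, B, hB, h1, h2, h3⟩
      · have hne : ∀ j ∈ J, j ≠ j₀ := by
          rintro j hj rfl
          exact hj₀ hj
        refine Or.inl ⟨Function.update f j₀ x₀, fun j hj => ?_, fun u hu v hv huv => ?_⟩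
        · rcases mem_insert.1 hj with rfl | hj
          · rwa [Function.update_self]
          · rw [Function.update_of_ne (hne j hj)]
            exact (mem_filter.1 (hf1 j hj)).1
        · rcases mem_insert.1 hu with rfl | hu' <;> rcases mem_insert.1 hv with rfl | hv'
          · exact absurd huv (H.not_adj_self _)
          · rw [Function.update_self, Function.update_of_ne (hne v hv')]
            exact (mem_filter.1 (hf1 v hv')).2.1 huv
          · rw [Function.update_self, Function.update_of_ne (hne u hu')]
            exact (mem_filter.1 (hf1 u hu')).2.2 huv
          · rw [Function.update_of_ne (hne v hv'), Function.update_of_ne (hne u hu')]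
            exact hf2 u hu' v hv' huv
      · rw [mul_assoc D, ← pow_succ', ← card_insert_of_notMem hj₀] at h1 h2
        exact Or.inr ⟨A, hA, B, hB, h1, h2, h3⟩
    · push Not at hx
      have hne : (V j₀).Nonempty := by
        have h1 := hV₀.2
        have h2 := hU.card_pos
        exact card_pos.1 (Nat.pos_of_ne_zero fun h0 => by rw [h0] at h1; omega)
      obtain ⟨j, hj, hcard⟩ := exists_card_le_mul_card hne ((card_le_univ J).trans (by simp))
        (m := h) (fun j => {x ∈ V j₀ | κ * #(N j x) < #(V j)}) (by
          intro x hxV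
          obtain ⟨j, hj, hlt⟩ := hx x hxV
          exact ⟨j, hj, mem_filter.2 ⟨hxV, hlt⟩⟩)
      set F := {x ∈ V j₀ | κ * #(N j x) < #(V j)} with hF
      have hVj := hV j (mem_insert_of_mem hj)
      have hh : 1 ≤ h := Nat.one_le_of_lt j.isLt
      have hpow : 1 ≤ κ ^ #(insert j₀ J) := Nat.one_le_pow _ _ hκ
      have hFU : F ⊆ U := (filter_subset _ _).trans hV₀.1
      have hFc : #U ≤ D * κ ^ #(insert j₀ J) * h * #F := by
        calc #U ≤ D * #(V j₀) := hV₀.2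
          _ ≤ D * (h * #F) := Nat.mul_le_mul_left _ hcard
          _ = D * 1 * h * #F := by ring
          _ ≤ _ := by gcongr
      have hVc : #U ≤ D * κ ^ #(insert j₀ J) * h * #(V j) := by
        calc #U ≤ D * #(V j) := hVj.2
          _ = D * 1 * 1 * #(V j) := by ring
          _ ≤ _ := by gcongr
      have hsum : κ * ∑ x ∈ F, #(N j x) ≤ #F * #(V j) := by
        rw [mul_sum, ← smul_eq_mul #F]
        exact sum_le_card_nsmul _ _ _ fun x hx => (mem_filter.1 hx).2.le
      have hjne : j₀ ≠ j := by
        rintro rfl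
        exact hj₀ hj
      rcases H.total j₀ j hjne with hadj | hadj
      · refine Or.inr ⟨V j, hVj.1, F, hFU, hVc, hFc, ?_⟩
        have hNj : ∀ x, N j x = {y ∈ V j | T.adj x y} := fun x => filter_congr fun y _ =>
          ⟨fun h => h.1 hadj, fun h => ⟨fun _ => h, fun h' => absurd h' (H.asymm _ _ hadj)⟩⟩
        simp only [hNj] at hsum
        rw [mul_comm #(V j)]
        refine le_trans (le_of_eq ?_) hsum
        congr 1
        exact (sum_card_bipartiteAbove_eq_sum_card_bipartiteBelow _).symm
      · refine Or.inr ⟨F, hFU, V j, hVj.1, hFc, hVc, ?_⟩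
        have hNj : ∀ x, N j x = {y ∈ V j | T.adj y x} := fun x => filter_congr fun y _ =>
          ⟨fun h => h.2 hadj, fun h => ⟨fun h' => absurd h' (H.asymm _ _ hadj), fun _ => h⟩⟩
        simpa only [hNj] using hsum

theorem exists_sparse_pair {h : ℕ} (H : Tournament h) (κ : ℕ) :
    ∃ C, 1 ≤ C ∧ ∀ (n : ℕ) (T : Tournament n), ¬ T.Contains H → ∀ U, C ≤ #U →
      ∃ A ⊆ U, ∃ B ⊆ U, #U ≤ C * #A ∧ #U ≤ C * #B ∧ κ * T.bad A B ≤ #A * #B := by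
  set C₀ := 1 * (2 * κ + 1) ^ #(univ : Finset (Fin h)) * h with hC₀
  have hpos : 1 ≤ (C₀ + 1) * (2 * κ + 1) := Nat.mul_pos (Nat.succ_pos _) (Nat.succ_pos _)
  have hle : C₀ ≤ (C₀ + 1) * (2 * κ + 1) := by nlinarith
  refine ⟨(C₀ + 1) * (2 * κ + 1), hpos, fun n T hT U hU => ?_⟩
  rcases exists_embedding_or_sparse H T (κ := 2 * κ + 1) (by omega) (card_pos.1 (hpos.trans hU))
    univ 1 (fun _ => U) (fun _ _ => ⟨subset_rfl, by omega⟩) with ⟨f, -, hf⟩ | ⟨A, hA, B, hB, h1, h2, h3⟩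
  · exact absurd (contains_of_forall_adj f fun u v => hf u (mem_univ _) v (mem_univ _)) hT
  · rw [← hC₀] at h1 h2
    refine ⟨A, hA, B, hB, h1.trans (Nat.mul_le_mul_right _ hle),
      h2.trans (Nat.mul_le_mul_right _ hle), ?_⟩
    have hBκ : 2 * κ + 1 ≤ #B := by
      by_contra! hlt
      have := Nat.mul_le_mul_left C₀ hlt.le
      nlinarith
    have hbad : T.bad A B ≤ ∑ x ∈ A, #{y ∈ B | T.adj y x} + #A := by
      rw [bad, card_eq_sum_ones, ← sum_add_distrib]
      refine sum_le_sum fun x _ => ?_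
      have hsub : {y ∈ B | ¬ T.adj x y} ⊆ {y ∈ B | T.adj y x} ∪ {x} := by
        intro y hy
        rw [mem_filter] at hy
        rw [mem_union, mem_filter, mem_singleton]
        by_cases hxy : y = x
        · exact Or.inr hxy
        · exact Or.inl ⟨hy.1, T.adj_of_not_adj hxy hy.2⟩
      exact (card_le_card hsub).trans (card_union_le _ _)
    set S := ∑ x ∈ A, #{y ∈ B | T.adj y x}
    have h4 := Nat.mul_le_mul_left (2 * κ) hbad
    have h5 := Nat.mul_le_mul_left #A hBκ
    nlinarith

theorem exists_sparse_sequence {h : ℕ} (H : Tournament h) (κ k : ℕ) :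
    ∃ C, 1 ≤ C ∧ ∀ (n : ℕ) (T : Tournament n), ¬ T.Contains H → ∀ U, C ≤ #U →
      ∃ A : ℕ → Finset (Fin n), (∀ i < k, A i ⊆ U ∧ #U ≤ C * #(A i)) ∧
        ∀ i j, i < j → j < k → κ * T.bad (A i) (A j) ≤ #(A i) * #(A j) := by
  induction k with
  | zero =>
    exact ⟨1, le_rfl, fun n T _ U _ => ⟨fun _ => U, fun i hi => absurd hi (Nat.not_lt_zero i),
      fun i j _ hj => absurd hj (Nat.not_lt_zero j)⟩⟩
  | succ k ih =>
    obtain ⟨C, hC1, hC⟩ := ih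
    obtain ⟨C', hC'1, hC'⟩ := exists_sparse_pair H (κ * C)
    refine ⟨C' * C, Nat.mul_pos hC'1 hC1, fun n T hT U hU => ?_⟩
    obtain ⟨A, hA, B, hB, h1, h2, h3⟩ := hC' n T hT U (le_trans (Nat.le_mul_of_pos_right _ hC1) hU)
    obtain ⟨A', hA', hsp⟩ := hC n T hT A (Nat.le_of_mul_le_mul_left (hU.trans h1) hC'1)
    refine ⟨fun i => if i < k then A' i else B, fun i hi => ?_, fun i j hij hj => ?_⟩
    · dsimp only
      by_cases hik : i < k
      · rw [if_pos hik, mul_assoc]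
        exact ⟨(hA' i hik).1.trans hA, h1.trans (Nat.mul_le_mul_left _ (hA' i hik).2)⟩
      · rw [if_neg hik]
        refine ⟨hB, h2.trans (Nat.mul_le_mul_right _ (Nat.le_mul_of_pos_right _ hC1))⟩
    · dsimp only
      have hik : i < k := by omega
      rw [if_pos hik]
      by_cases hjk : j < k
      · rw [if_pos hjk]
        exact hsp i j hij hjk
      · rw [if_neg hjk]
        have h4 := Nat.mul_le_mul_left (κ * C) (T.bad_mono (hA' i hik).1 (Subset.refl B))
        have h5 := Nat.mul_le_mul_right #B (hA' i hik).2
        refine Nat.le_of_mul_le_mul_left ?_ hC1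
        calc C * (κ * T.bad (A' i) B) = κ * C * T.bad (A' i) B := by ring
          _ ≤ C * #(A' i) * #B := h4.trans (h3.trans h5)
          _ = C * (#(A' i) * #B) := by ring

/-- No triple of `A × B × D` induces the three-vertex middle star. -/
def NoMid {n : ℕ} (T : Tournament n) (A B D : Finset (Fin n)) : Prop :=
  ∀ a ∈ A, ∀ b ∈ B, ∀ d ∈ D, T.adj b a → T.adj d b → ¬ T.adj a d

theorem exists_sparse_triple {h : ℕ} {H : Tournament h} (hH : H.IsCentralNebula) (κ : ℕ) :
    ∃ C, 1 ≤ C ∧ ∀ (n : ℕ) (T : Tournament n), ¬ T.Contains H → ∀ U, C ≤ #U →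
      ∃ A ⊆ U, ∃ B ⊆ U, ∃ D ⊆ U, #U ≤ C * #A ∧ #U ≤ C * #B ∧ #U ≤ C * #D ∧
        κ * T.bad A B ≤ #A * #B ∧ κ * T.bad B D ≤ #B * #D ∧ κ * T.bad A D ≤ #A * #D ∧
        T.NoMid A B D := by
  obtain ⟨θ, k, Q, ctr, ⟨-, hQ, hback⟩, hmid⟩ := hH
  obtain ⟨C, hC1, hC⟩ := exists_sparse_sequence H (4 * h * (2 * h) + κ * (4 * 4)) h
  refine ⟨C * 4, by omega, fun n T hT U hU => ?_⟩
  obtain ⟨A, hA, hsp⟩ := hC n T hT U (by omega)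
  set r : Fin h → ℕ := fun v => (pos θ v).val with hr
  have hrinj : Function.Injective r := Fin.val_injective.comp θ.symm.injective
  have hV : T.SparseFam r (4 * h * (2 * h) + κ * (4 * 4)) (fun v => A (r v)) :=
    fun u v huv => hsp _ _ huv (pos θ v).isLt
  have hV₁ : T.SparseFam r (4 * Fintype.card (Fin h) * (2 * h)) (fun v => A (r v)) :=
    hV.of_le (by simp)
  obtain ⟨V, hVA, hsm⟩ := hV₁.exists_smooth
  have hAr : ∀ v, A (r v) ⊆ U ∧ #U ≤ C * #(A (r v)) := fun v => hA _ (pos θ v).isLt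
  by_contra hcon
  refine hT (contains_of_smooth H T hrinj Q ctr (fun i => (hmid i).1.1) hQ
    (fun u v huv hlt => hback u v ⟨huv, hlt⟩) V (fun v => ?_) hsm fun i W hW => ?_)
  · have h1 := (hVA v).2
    have h2 := (hAr v).2
    refine card_pos.1 (Nat.pos_of_ne_zero fun h0 => ?_)
    have h3 : #(A (r v)) = 0 := by omega
    rw [h3] at h2
    omega
  · obtain ⟨⟨hc, ⟨l, hl, hlc⟩, ⟨d, hd, hcd⟩, hadj, hbk⟩, hcard⟩ := hmid i
    set c := ctr i with hcdef
    rw [mem_erase] at hl hd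
    have hld : l ≠ d := by
      rintro rfl
      exact lt_asymm hlc hcd
    have hQi : ∀ v ∈ Q i, v = l ∨ v = c ∨ v = d := by
      have hsub : ({l, c, d} : Finset (Fin h)) ⊆ Q i := by
        intro v hv
        simp only [mem_insert, mem_singleton] at hv
        rcases hv with rfl | rfl | rfl
        exacts [hl.2, hc, hd.2]
      have h3 : #({l, c, d} : Finset (Fin h)) = 3 := card_eq_three.2
        ⟨l, c, d, hl.1, hld, hd.1.symm, rfl⟩
      rw [← eq_of_subset_of_card_le hsub (by omega)]
      simp
    have hWA : ∀ v ∈ Q i, W v ⊆ A (r v) ∧ #(A (r v)) ≤ 4 * #(W v) := by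
      intro v hv
      have h1 := (hVA v).2
      have h2 := (hW v hv).2
      exact ⟨(hW v hv).1.trans (hVA v).1, by omega⟩
    have hWU : ∀ v ∈ Q i, W v ⊆ U ∧ #U ≤ C * 4 * #(W v) := by
      intro v hv
      refine ⟨(hWA v hv).1.trans (hAr v).1, (hAr v).2.trans ?_⟩
      rw [mul_assoc]
      exact Nat.mul_le_mul_left _ (hWA v hv).2
    have hWsp : ∀ u ∈ Q i, ∀ v ∈ Q i, r u < r v → κ * T.bad (W u) (W v) ≤ #(W u) * #(W v) :=
      fun u hu v hv huv => T.bad_of_subset (hWA u hu).1 (hWA v hv).1 (hWA u hu).2 (hWA v hv).2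
        (hV.of_le (Nat.le_add_left _ _) u v huv)
    have hmidW : ¬ T.NoMid (W l) (W c) (W d) := fun hno => hcon
      ⟨W l, (hWU l hl.2).1, W c, (hWU c hc).1, W d, (hWU d hd.2).1, (hWU l hl.2).2,
        (hWU c hc).2, (hWU d hd.2).2, hWsp l hl.2 c hc hlc, hWsp c hc d hd.2 hcd,
        hWsp l hl.2 d hd.2 (lt_trans hlc hcd), hno⟩
    unfold NoMid at hmidW
    push Not at hmidW
    obtain ⟨x, hx, y, hy, z, hz, hyx, hzy, hxz⟩ := hmidW
    have hcl : H.adj c l := (hadj l (mem_erase.2 hl)).1 hlc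
    have hdc : H.adj d c := (hadj d (mem_erase.2 hd)).2 hcd
    have hld' : H.adj l d := H.adj_of_not_adj hld fun hdl => by
      rcases hbk d hd.2 l hl.2 ⟨hdl, hlc.trans hcd⟩ with h | h
      exacts [hd.1 h, hl.1 h]
    set f : Fin h → Fin n := fun v => if v = l then x else if v = c then y else z with hf
    have hfl : f l = x := if_pos rfl
    have hfc : f c = y := by simp [hf, hl.1.symm]
    have hfd : f d = z := by simp [hf, hld.symm, hd.1]
    refine ⟨f, fun v hv => ?_, fun u hu v hv huv => ?_⟩
    · rcases hQi v hv with rfl | rfl | rfl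
      · rwa [hfl]
      · rwa [hfc]
      · rwa [hfd]
    · rcases hQi u hu with rfl | rfl | rfl <;> rcases hQi v hv with rfl | rfl | rfl
      · exact absurd huv (H.not_adj_self _)
      · exact absurd huv (H.asymm _ _ hcl)
      · rwa [hfl, hfd]
      · rwa [hfl, hfc]
      · exact absurd huv (H.not_adj_self _)
      · exact absurd huv (H.asymm _ _ hdc)
      · exact absurd huv (H.asymm _ _ hld')
      · rwa [hfc, hfd]
      · exact absurd huv (H.not_adj_self _)

/-- Long sparse sequences with a prescribed middle set that is the center of no middle star. -/
theorem exists_sparse_sequence_noMid {h : ℕ} {H : Tournament h} (hH : H.IsCentralNebula)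
    (κ K q : ℕ) :
    ∃ C, 1 ≤ C ∧ ∀ (n : ℕ) (T : Tournament n), ¬ T.Contains H → ∀ U, C ≤ #U →
      ∃ L : ℕ → Finset (Fin n), (∀ i < K, L i ⊆ U ∧ #U ≤ C * #(L i)) ∧
        (∀ i j, i < j → j < K → κ * T.bad (L i) (L j) ≤ #(L i) * #(L j)) ∧
        ∀ i k, i < q → q < k → k < K → T.NoMid (L i) (L q) (L k) := by
  obtain ⟨C₂, hC₂1, hC₂⟩ := exists_sparse_sequence H κ K
  obtain ⟨C₁, hC₁1, hC₁⟩ := exists_sparse_triple hH (κ * (C₂ * C₂))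
  refine ⟨C₁ * C₂, Nat.mul_pos hC₁1 hC₂1, fun n T hT U hU => ?_⟩
  obtain ⟨A, hA, B, hB, D, hD, hAc, hBc, hDc, hAB, hBD, hAD, hno⟩ :=
    hC₁ n T hT U (le_trans (Nat.le_mul_of_pos_right _ hC₂1) hU)
  obtain ⟨X, hX, hXsp⟩ := hC₂ n T hT A (Nat.le_of_mul_le_mul_left (hU.trans hAc) hC₁1)
  obtain ⟨Z, hZ, hZsp⟩ := hC₂ n T hT D (Nat.le_of_mul_le_mul_left (hU.trans hDc) hC₁1)
  have hB' : #B ≤ C₂ * #B := Nat.le_mul_of_pos_left _ hC₂1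
  set L : ℕ → Finset (Fin n) := fun i => if i < q then X i else if i = q then B else Z i with hL
  have hL1 : ∀ i, i < q → L i = X i := fun i hi => if_pos hi
  have hL2 : L q = B := by simp [hL]
  have hL3 : ∀ i, q < i → L i = Z i := fun i hi => by
    simp [hL, not_lt.2 hi.le, hi.ne']
  refine ⟨L, fun i hi => ?_, fun i j hij hj => ?_, fun i k hi hk hkK => ?_⟩
  · rw [mul_assoc]
    rcases lt_trichotomy i q with h | rfl | h
    · rw [hL1 i h]
      exact ⟨(hX i hi).1.trans hA, hAc.trans (Nat.mul_le_mul_left _ (hX i hi).2)⟩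
    · rw [hL2]
      exact ⟨hB, hBc.trans (Nat.mul_le_mul_left _ hB')⟩
    · rw [hL3 i h]
      exact ⟨(hZ i hi).1.trans hD, hDc.trans (Nat.mul_le_mul_left _ (hZ i hi).2)⟩
  · have hi : i < K := hij.trans hj
    rcases lt_trichotomy i q with h | rfl | h
    · rw [hL1 i h]
      rcases lt_trichotomy j q with h' | rfl | h'
      · rw [hL1 j h']
        exact hXsp i j hij hj
      · rw [hL2]
        exact T.bad_of_subset (hX i hi).1 subset_rfl (hX i hi).2 hB' hAB
      · rw [hL3 j h']
        exact T.bad_of_subset (hX i hi).1 (hZ j hj).1 (hX i hi).2 (hZ j hj).2 hAD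
    · rw [hL2, hL3 j hij]
      exact T.bad_of_subset subset_rfl (hZ j hj).1 hB' (hZ j hj).2 hBD
    · rw [hL3 i h, hL3 j (h.trans hij)]
      exact hZsp i j hij hj
  · rw [hL1 i hi, hL2, hL3 k hk]
    intro a ha b hb d hd
    exact hno a ((hX i ((hi.trans hk).trans hkK)).1 ha) b hb d ((hZ k hkK).1 hd)

/-! ### Embedding an LR-Δgalaxy in a near-critical set -/

theorem IsNearCritical.of_le {n : ℕ} {T : Tournament n} {C C' M : ℕ} {U : Finset (Fin n)}
    (hU : T.IsNearCritical C' M U) (h : C ≤ C') : T.IsNearCritical C M U :=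
  ⟨hU.1, fun s hs hsc => hU.2 s hs (hsc.trans (Nat.mul_le_mul_right _ h))⟩

theorem IsNearCritical.lt_card {n : ℕ} {T : Tournament n} {C M : ℕ} {U : Finset (Fin n)}
    (hU : T.IsNearCritical C M U) (hC : 4 ≤ C) (hM : 2 ≤ M) : C < #U := by
  by_contra! hle
  have ht := hU.lt_trSizeOn hC
  obtain ⟨v, hv⟩ : U.Nonempty := card_pos.1 (by have := hU.1; omega)
  have h1 := hU.2 {v} (singleton_subset_iff.2 hv) (by simpa using hle)
  obtain ⟨t, ht1, -, ht2⟩ := T.exists_isTransOn_card_eq {v}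
  have h2 : T.trSizeOn {v} ≤ 1 := by
    rw [← ht2]
    simpa using card_le_card ht1
  have h3 := Nat.mul_le_mul_left M h2
  nlinarith

theorem IsNearCritical.exists_isTransOn {n : ℕ} {T : Tournament n} {C M : ℕ}
    {U L : Finset (Fin n)} (hU : T.IsNearCritical C M U) (hM : 2 ≤ M) (hL : L ⊆ U)
    (hLc : #U ≤ C * #L) : ∃ R ⊆ L, R ⊆ U ∧ T.IsTransOn R ∧ T.trSizeOn U ≤ 2 * #R := by
  obtain ⟨R, hR, hRt, hRc⟩ := T.exists_isTransOn_card_eq L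
  refine ⟨R, hR, hR.trans hL, hRt, ?_⟩
  have h := hU.2 L hL hLc
  rw [hRc]
  by_contra! hlt
  nlinarith

/-- Long sparse sequences whose members of even index are large transitive sets, with a
prescribed middle set that is the center of no middle star. -/
theorem exists_alternating_sequence {h : ℕ} {H : Tournament h} (hH : H.IsCentralNebula)
    (κ K q : ℕ) :
    ∃ C, 4 ≤ C ∧ ∀ (n : ℕ) (T : Tournament n), ¬ T.Contains H → ∀ M U, 2 ≤ M →
      T.IsNearCritical C M U →
      ∃ R : ℕ → Finset (Fin n), (∀ i < K, R i ⊆ U) ∧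
        (∀ i < K, Even i → T.IsTransOn (R i) ∧ T.trSizeOn U ≤ 2 * #(R i)) ∧
        (∀ i < K, Odd i → #U ≤ C * #(R i)) ∧
        (∀ i j, i < j → j < K → κ * T.bad (R i) (R j) ≤ #(R i) * #(R j)) ∧
        ∀ i k, i < q → q < k → k < K → T.NoMid (R i) (R q) (R k) := by
  set s : Finset (Fin K) := univ.filter fun i => Even i.val with hs
  obtain ⟨C, hC1, hC⟩ := exists_sparse_sequence_noMid hH
    ((2 * Fintype.card (Fin K)) ^ #s * κ) K q
  refine ⟨C * 4, by omega, fun n T hT M U hM hU => ?_⟩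
  have hUc := hU.lt_card (by omega) hM
  obtain ⟨L, hL, hsp, hno⟩ := hC n T hT U (by omega)
  obtain ⟨V, hV1, hV2, hV3, hV4⟩ := SparseFam.exists_replace (T := T) (r := fun i : Fin K => i.val)
    (fun R => R ⊆ U ∧ T.IsTransOn R ∧ T.trSizeOn U ≤ 2 * #R) s (fun i => L i)
    (fun i j hij => hsp i j hij j.isLt) (by
      intro i _ X hX hXc
      refine hU.exists_isTransOn hM (hX.trans (hL i i.isLt).1) ?_
      calc #U ≤ C * #(L i) := (hL i i.isLt).2
        _ ≤ C * (4 * #X) := Nat.mul_le_mul_left _ (by omega)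
        _ = C * 4 * #X := by ring)
  set R : ℕ → Finset (Fin n) := fun i => if hi : i < K then V ⟨i, hi⟩ else L i with hR
  have hRK : ∀ i (hi : i < K), R i = V ⟨i, hi⟩ := fun i hi => dif_pos hi
  have hRL : ∀ i, R i ⊆ L i := by
    intro i
    by_cases hi : i < K
    · rw [hRK i hi]
      exact hV1 ⟨i, hi⟩
    · simp [hR, hi]
  refine ⟨R, fun i hi => (hRL i).trans (hL i hi).1, fun i hi he => ?_, fun i hi ho => ?_,
    fun i j hij hj => ?_, fun i k hi hk hkK a ha b hb d hd =>
      hno i k hi hk hkK a (hRL i ha) b (hRL q hb) d (hRL k hd)⟩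
  · rw [hRK i hi]
    exact (hV2 ⟨i, hi⟩ (mem_filter.2 ⟨mem_univ _, he⟩)).2
  · rw [hRK i hi, hV3 ⟨i, hi⟩ fun h => Nat.not_even_iff_odd.2 ho (mem_filter.1 h).2]
    exact (hL i hi).2.trans (Nat.mul_le_mul_right _ (by omega))
  · rw [hRK i (hij.trans hj), hRK j hj]
    exact hV4 ⟨i, hij.trans hj⟩ ⟨j, hj⟩ hij

/-- Group indices of ordered vertices, where every vertex satisfying `Z` forms a group of its own
with odd index and maximal intervals of other vertices form groups with even index. -/
theorem exists_grouping {h : ℕ} (r : Fin h → ℕ) (hr : Function.Injective r) (Z : Fin h → Prop) :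
    ∃ g : Fin h → ℕ, (∀ v, g v < 2 * h + 2) ∧ (∀ v, Z v → Odd (g v)) ∧ (∀ v, ¬ Z v → Even (g v)) ∧
      (∀ u v, r u < r v → g u ≤ g v) ∧ (∀ u v, r u < r v → (Z u ∨ Z v) → g u < g v) ∧
      ∀ u v, r u < r v → ¬ Z u → ¬ Z v → (∀ w, Z w → r u < r w → ¬ r w < r v) → g u = g v := by
  set z : Fin h → ℕ := fun v => #{w : Fin h | Z w ∧ r w < r v} with hz
  set g : Fin h → ℕ := fun v => 2 * z v + if Z v then 1 else 0 with hg
  have hg1 : ∀ v, Z v → g v = 2 * z v + 1 := fun v hv => by simp [hg, hv]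
  have hg0 : ∀ v, ¬ Z v → g v = 2 * z v := fun v hv => by simp [hg, hv]
  have hzle : ∀ v, z v ≤ h := fun v => (card_le_univ _).trans (by simp)
  have hmono : ∀ u v, r u < r v → z u ≤ z v := fun u v huv =>
    card_le_card fun w hw => by
      rw [mem_filter] at hw ⊢
      exact ⟨hw.1, hw.2.1, hw.2.2.trans huv⟩
  have hlt : ∀ u v, r u < r v → Z u → z u < z v := fun u v huv hu =>
    card_lt_card ((Finset.ssubset_iff_of_subset fun w hw => by
      rw [mem_filter] at hw ⊢
      exact ⟨hw.1, hw.2.1, hw.2.2.trans huv⟩).2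
      ⟨u, mem_filter.2 ⟨mem_univ _, hu, huv⟩, fun hm => lt_irrefl _ (mem_filter.1 hm).2.2⟩)
  refine ⟨g, fun v => ?_, fun v hv => ⟨z v, hg1 v hv⟩, fun v hv => ⟨z v, by rw [hg0 v hv]; ring⟩,
    fun u v huv => ?_, fun u v huv hZ => ?_, fun u v huv hu hv hw => ?_⟩
  · have := hzle v
    by_cases hv : Z v
    · rw [hg1 v hv]; omega
    · rw [hg0 v hv]; omega
  · have h1 := hmono u v huv
    have h2 : 2 * z v ≤ g v := Nat.le_add_right _ _
    by_cases hu : Z u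
    · have := hlt u v huv hu
      rw [hg1 u hu]; omega
    · rw [hg0 u hu]; omega
  · have h1 := hmono u v huv
    have h2 : 2 * z v ≤ g v := Nat.le_add_right _ _
    by_cases hu : Z u
    · have := hlt u v huv hu
      rw [hg1 u hu]; omega
    · rw [hg0 u hu, hg1 v (hZ.resolve_left hu)]; omega
  · rw [hg0 u hu, hg0 v hv]
    refine congrArg (2 * ·) (congrArg card (filter_congr fun w _ =>
      ⟨fun hm => ⟨hm.1, hm.2.trans huv⟩, fun hm => ⟨hm.1, ?_⟩⟩))
    refine lt_of_le_of_ne (not_lt.1 fun h => hw w hm.1 h hm.2) fun h => ?_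
    rw [hr h] at hm
    exact hu hm.1

theorem exists_grouped_family {h h' : ℕ} {H : Tournament h'} (hH : H.IsCentralNebula)
    (r : Fin h → ℕ) (hr : Function.Injective r) (hrh : ∀ v, r v < h) (Z : Fin h → Prop)
    {b : Fin h} (hb : Z b) (κ : ℕ) :
    ∃ C, 4 ≤ C ∧ ∀ (n : ℕ) (T : Tournament n), ¬ T.Contains H → ∀ M U, 2 * h ≤ M →
      T.IsNearCritical C M U →
      ∃ V : Fin h → Finset (Fin n), (∀ v, V v ⊆ U) ∧ (∀ v, Z v → #U ≤ C * #(V v)) ∧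
        (∀ v, ¬ Z v → T.IsTransOn (V v) ∧ T.trSizeOn U ≤ 4 * h * #(V v)) ∧
        T.SparseFam r κ V ∧
        (∀ u v, r u < r b → r b < r v → T.NoMid (V u) (V b) (V v)) ∧
        ∀ u v, r u < r v → ¬ Z u → ¬ Z v → (∀ w, Z w → r u < r w → ¬ r w < r v) →
          ∀ x ∈ V u, ∀ y ∈ V v, T.adj x y := by
  obtain ⟨g, hgK, hgo, hge, hgm, hgl, hgeq⟩ := exists_grouping r hr Z
  have hh : 0 < h := Nat.lt_of_le_of_lt (Nat.zero_le _) b.isLt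
  obtain ⟨C, hC4, hC⟩ := exists_alternating_sequence hH (κ * (2 * h * (2 * h))) (2 * h + 2) (g b)
  refine ⟨C, hC4, fun n T hT M U hM hU => ?_⟩
  obtain ⟨R, hRU, hRe, hRo, hsp, hno⟩ := hC n T hT M U (by omega) hU
  have ht := hU.lt_trSizeOn hC4
  have hch : ∀ i, ∃ ch : ℕ → Finset (Fin n), i < 2 * h + 2 → Even i →
      (∀ k < h, ch k ⊆ R i ∧ #(R i) ≤ 2 * h * #(ch k)) ∧
        ∀ k l, k < l → ∀ x ∈ ch k, ∀ y ∈ ch l, T.adj x y := by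
    intro i
    by_cases hi : i < 2 * h + 2 ∧ Even i
    · have h1 := hRe i hi.1 hi.2
      obtain ⟨ch, hch⟩ := h1.1.exists_chunks hh (by omega)
      exact ⟨ch, fun _ _ => hch⟩
    · exact ⟨fun _ => ∅, fun h1 h2 => absurd ⟨h1, h2⟩ hi⟩
  choose ch hch using hch
  set V : Fin h → Finset (Fin n) := fun v => if Z v then R (g v) else ch (g v) (r v) with hVdef
  have hV1 : ∀ v, Z v → V v = R (g v) := fun v hv => if_pos hv
  have hV0 : ∀ v, ¬ Z v → V v = ch (g v) (r v) := fun v hv => if_neg hv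
  have hVR : ∀ v, V v ⊆ R (g v) ∧ #(R (g v)) ≤ 2 * h * #(V v) := by
    intro v
    by_cases hv : Z v
    · rw [hV1 v hv]
      exact ⟨subset_rfl, Nat.le_mul_of_pos_left _ (by omega)⟩
    · rw [hV0 v hv]
      exact (hch _ (hgK v) (hge v hv)).1 _ (hrh v)
  have hadj : ∀ u v, r u < r v → ¬ Z u → ¬ Z v → g u = g v →
      ∀ x ∈ V u, ∀ y ∈ V v, T.adj x y := by
    intro u v huv hu hv hguv
    rw [hV0 u hu, hV0 v hv, hguv]
    exact (hch _ (hgK v) (hge v hv)).2 _ _ huv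
  refine ⟨V, fun v => (hVR v).1.trans (hRU _ (hgK v)), fun v hv => ?_, fun v hv => ?_,
    fun u v huv => ?_, fun u v hu hv x hx y hy w hw => ?_, fun u v huv hu hv hw =>
      hadj u v huv hu hv (hgeq u v huv hu hv hw)⟩
  · rw [hV1 v hv]
    exact hRo _ (hgK v) (hgo v hv)
  · obtain ⟨h1, h2⟩ := hRe _ (hgK v) (hge v hv)
    refine ⟨h1.mono (hVR v).1, ?_⟩
    have h3 := (hVR v).2
    calc T.trSizeOn U ≤ 2 * #(R (g v)) := h2
      _ ≤ 2 * (2 * h * #(V v)) := Nat.mul_le_mul_left _ h3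
      _ = 4 * h * #(V v) := by ring
  · rcases (hgm u v huv).lt_or_eq with hlt | heq
    · exact T.bad_of_subset (hVR u).1 (hVR v).1 (hVR u).2 (hVR v).2 (hsp _ _ hlt (hgK v))
    · have hu : ¬ Z u := fun hu => (hgl u v huv (Or.inl hu)).ne heq
      have hv : ¬ Z v := fun hv => (hgl u v huv (Or.inr hv)).ne heq
      have h0 : T.bad (V u) (V v) = 0 := sum_eq_zero fun x hx =>
        card_eq_zero.2 (filter_eq_empty_iff.2 fun y hy =>
          not_not.2 (hadj u v huv hu hv heq x hx y hy))
      rw [h0, mul_zero]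
      exact Nat.zero_le _
  · exact hno _ _ (hgl u b hu (Or.inr hb)) (hgl b v hv (Or.inl hb)) (hgK v) x ((hVR u).1 hx) y
      ((hVR b).1 hy) w ((hVR v).1 hw)

theorem exists_contains_of_isNearCritical {h₁ h : ℕ} {H₁ : Tournament h₁} {H : Tournament h}
    (hH₁ : H₁.IsCentralNebula) (hH : H.IsLRDeltaGalaxy) :
    ∃ C M, 1 ≤ C ∧ 2 ≤ M ∧ ∀ (n : ℕ) (T : Tournament n) (U : Finset (Fin n)),
      ¬ T.Contains H₁ → T.IsNearCritical C M U → T.Contains H := by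
  obtain ⟨θ, a, b, c, k, Q, ctr, htri, hfr, -, hdis, hQ, hback, hctr, hforb⟩ := hH
  obtain ⟨hab, hbc, hba, hca, hcb⟩ := htri 0
  have hh : 0 < h := Nat.lt_of_le_of_lt (Nat.zero_le _) b.isLt
  set r : Fin h → ℕ := fun v => (pos θ v).val with hr
  have hrinj : Function.Injective r := Fin.val_injective.comp θ.symm.injective
  set Z : Fin h → Prop := fun v => v = b ∨ ∃ j, v = ctr j with hZ
  have hctrQ : ∀ j, ctr j ∈ Q j := fun j => (hfr j).elim (fun h => h.1) (fun h => h.1)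
  have htriQ : ∀ v ∈ ({a, b, c} : Finset (Fin h)), ∀ j, v ∉ Q j := fun v hv j hvj =>
    disjoint_left.1 (hdis 0 j) hv hvj
  have haZ : ¬ Z a := by
    rintro (rfl | ⟨j, rfl⟩)
    · exact lt_irrefl _ hab
    · exact htriQ _ (by simp) j (hctrQ j)
  have hcZ : ¬ Z c := by
    rintro (rfl | ⟨j, rfl⟩)
    · exact lt_irrefl _ hbc
    · exact htriQ _ (by simp) j (hctrQ j)
  have hleaf : ∀ j, ∀ v ∈ (Q j).erase (ctr j), ¬ Z v := by
    intro j v hv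
    rw [mem_erase] at hv
    rintro (rfl | ⟨i, rfl⟩)
    · exact htriQ _ (by simp) j hv.2
    · refine disjoint_left.1 (hQ i j ?_) (hctrQ i) hv.2
      rintro rfl
      exact hv.1 rfl
  have hbetween : ∀ j, ∀ u ∈ (Q j).erase (ctr j), ∀ v ∈ (Q j).erase (ctr j), ∀ w, Z w →
      r u < r w → ¬ r w < r v := by
    rintro j u hu v hv w (rfl | ⟨i, rfl⟩) huw hwv
    · exact hforb 0 j w (mem_singleton_self w) ⟨u, hu, v, hv, huw, hwv⟩
    · by_cases hij : i = j
      · subst hij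
        rcases hfr i with hs | hs
        · exact lt_asymm (hs.2.2.1 u hu).1 huw
        · exact lt_asymm (hs.2.2.1 v hv).1 hwv
      · exact hctr i j hij ⟨u, hu, v, hv, huw, hwv⟩
  obtain ⟨C, hC4, hC⟩ := exists_grouped_family hH₁ r hrinj (fun v => (pos θ v).isLt) Z
    (b := b) (Or.inl rfl) (4 * Fintype.card (Fin h) * (2 * h))
  refine ⟨h * (C * 4) + C, 32 * h, by omega, by omega, fun n T U hT hU => ?_⟩
  obtain ⟨V₀, hV₀U, hV₀Z, hV₀t, hV₀sp, hno, hV₀adj⟩ := hC n T hT (32 * h) U (by omega)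
    (hU.of_le (Nat.le_add_left _ _))
  obtain ⟨V, hV, hsm⟩ := hV₀sp.exists_smooth
  have hUne := hU.lt_card (by omega) (by omega)
  have ht := hU.lt_trSizeOn (by omega)
  have hVne : ∀ v, (V v).Nonempty := by
    intro v
    have h1 := (hV v).2
    refine card_pos.1 (Nat.pos_of_ne_zero fun h0 => ?_)
    have h2 : #(V₀ v) = 0 := by omega
    by_cases hv : Z v
    · have h3 := hV₀Z v hv
      rw [h2] at h3
      omega
    · have h3 := (hV₀t v hv).2
      rw [h2] at h3
      omega
  have hlocal : ∀ (y₀ : Fin h) (J : Finset (Fin h)) (d : Fin h → Prop)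
      (W : Fin h → Finset (Fin n)), Z y₀ → (∀ v ∈ J, ¬ Z v) →
      (∀ v ∈ insert y₀ J, W v ⊆ V v ∧ #(V v) ≤ 2 * #(W v)) →
      ∃ f : Fin h → Fin n, (∀ v ∈ insert y₀ J, f v ∈ W v) ∧
        ∀ v ∈ J, (d v → T.adj (f y₀) (f v)) ∧ (¬ d v → T.adj (f v) (f y₀)) := by
    intro y₀ J d W hy₀ hJ hW
    have hW₀ : ∀ v ∈ insert y₀ J, W v ⊆ V₀ v ∧ #(V₀ v) ≤ 4 * #(W v) := by
      intro v hv
      have h1 := (hV v).2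
      have h2 := (hW v hv).2
      exact ⟨(hW v hv).1.trans (hV v).1, by omega⟩
    obtain ⟨y, hy, hyJ⟩ := hU.exists_forall_exists_adj (C' := C * 4) (M' := 16 * h) (m := h)
      (by omega) (Nat.le_add_right _ _) (by omega) ((card_le_univ J).trans (by simp)) W d
      (fun j hj => by
        have hj' := hW₀ j (mem_insert_of_mem hj)
        obtain ⟨h1, h2⟩ := hV₀t j (hJ j hj)
        refine ⟨hj'.1.trans (hV₀U j), h1.mono hj'.1, h2.trans ?_⟩
        calc 4 * h * #(V₀ j) ≤ 4 * h * (4 * #(W j)) := Nat.mul_le_mul_left _ hj'.2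
          _ = 16 * h * #(W j) := by ring)
      ((hW₀ y₀ (mem_insert_self _ _)).1.trans (hV₀U y₀))
      (by
        have h1 := (hW₀ y₀ (mem_insert_self _ _)).2
        calc #U ≤ C * #(V₀ y₀) := hV₀Z y₀ hy₀
          _ ≤ C * (4 * #(W y₀)) := Nat.mul_le_mul_left _ h1
          _ = C * 4 * #(W y₀) := by ring)
    have : Nonempty (Fin n) := ⟨y⟩
    choose! x hx hxd using hyJ
    have hne : ∀ v ∈ J, v ≠ y₀ := by
      rintro v hv rfl
      exact hJ v hv hy₀
    refine ⟨Function.update x y₀ y, fun v hv => ?_, fun v hv => ?_⟩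
    · rcases mem_insert.1 hv with rfl | hv
      · rwa [Function.update_self]
      · rw [Function.update_of_ne (hne v hv)]
        exact hx v hv
    · rw [Function.update_self, Function.update_of_ne (hne v hv)]
      exact hxd v hv
  have hadj : ∀ j, ∀ u ∈ (Q j).erase (ctr j), ∀ v ∈ (Q j).erase (ctr j), r u < r v →
      ∀ x ∈ V u, ∀ y ∈ V v, T.adj x y := fun j u hu v hv huv x hx y hy =>
    hV₀adj u v huv (hleaf j u hu) (hleaf j v hv) (hbetween j u hu v hv) x ((hV u).1 hx) y
      ((hV v).1 hy)
  refine contains_of_smooth H T hrinj (fun o : Option (Fin k) => o.elim {a, b, c} Q)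
    (fun o => o.elim b ctr) ?_ ?_ ?_ V hVne hsm ?_
  · rintro (_ | j)
    · simp
    · exact hctrQ j
  · rintro (_ | i) (_ | j) hij
    · exact absurd rfl hij
    · exact hdis 0 j
    · exact (hdis 0 i).symm
    · exact hQ i j fun h => hij (congrArg some h)
  · intro u v huv hlt
    rcases hback u v ⟨huv, hlt⟩ with ⟨_, hu, hv⟩ | ⟨j, hu, hv⟩
    · exact ⟨none, hu, hv⟩
    · exact ⟨some j, hu, hv⟩
  · rintro (_ | j) W hW
    · change ∀ v ∈ ({a, b, c} : Finset (Fin h)), _ at hW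
      change ∃ f : Fin h → Fin n, (∀ v ∈ ({a, b, c} : Finset (Fin h)), _) ∧
        ∀ u ∈ ({a, b, c} : Finset (Fin h)), ∀ v ∈ ({a, b, c} : Finset (Fin h)), _
      obtain ⟨f, hf1, hf2⟩ := hlocal b {a, c} (fun v => v = a) W (Or.inl rfl)
        (by
          intro v hv
          rcases mem_insert.1 hv with rfl | hv
          · exact haZ
          · rwa [mem_singleton.1 hv])
        (by rwa [insert_comm] at hW)
      rw [insert_comm] at hf1
      have hne : c ≠ a := by
        rintro rfl
        exact lt_asymm hab hbc
      have hTba : T.adj (f b) (f a) := (hf2 a (by simp)).1 rfl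
      have hTcb : T.adj (f c) (f b) := (hf2 c (by simp)).2 hne
      have hmem : ∀ v ∈ ({a, b, c} : Finset (Fin h)), f v ∈ V₀ v := fun v hv =>
        (hV v).1 ((hW v hv).1 (hf1 v hv))
      have hTca : T.adj (f c) (f a) := by
        refine T.adj_of_not_adj (fun he => ?_) (hno a c hab hbc _ (hmem a (by simp)) _
          (hmem b (by simp)) _ (hmem c (by simp)) hTba hTcb)
        rw [he] at hTcb
        exact T.asymm _ _ hTcb hTba
      refine ⟨f, hf1, fun u hu v hv huv => ?_⟩
      simp only [mem_insert, mem_singleton] at hu hv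
      rcases hu with rfl | rfl | rfl <;> rcases hv with rfl | rfl | rfl
      · exact absurd huv (H.not_adj_self _)
      · exact absurd huv (H.asymm _ _ hba)
      · exact absurd huv (H.asymm _ _ hca)
      · exact hTba
      · exact absurd huv (H.not_adj_self _)
      · exact absurd huv (H.asymm _ _ hcb)
      · exact hTca
      · exact hTcb
      · exact absurd huv (H.not_adj_self _)
    · change ∀ v ∈ Q j, _ at hW
      change ∃ f : Fin h → Fin n, (∀ v ∈ Q j, _) ∧ ∀ u ∈ Q j, ∀ v ∈ Q j, _
      have hins := insert_erase (hctrQ j)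
      obtain ⟨f, hf1, hf2⟩ := hlocal (ctr j) ((Q j).erase (ctr j)) (H.adj (ctr j)) W
        (Or.inr ⟨j, rfl⟩) (hleaf j) (by rwa [hins])
      rw [hins] at hf1
      refine ⟨f, hf1, fun u hu v hv huv => ?_⟩
      by_cases huc : u = ctr j
      · subst huc
        exact (hf2 v (mem_erase.2 ⟨(H.ne_of_adj huv).symm, hv⟩)).1 huv
      by_cases hvc : v = ctr j
      · subst hvc
        exact (hf2 u (mem_erase.2 ⟨huc, hu⟩)).2 (H.asymm _ _ huv)
      have huv' : r u < r v := by
        refine lt_of_le_of_ne (not_lt.1 fun hlt => ?_) fun h => H.ne_of_adj huv (hrinj h)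
        rcases hfr j with hs | hs
        · exact hvc (hs.2.2.2 u hu v hv ⟨huv, hlt⟩)
        · exact huc (hs.2.2.2 u hu v hv ⟨huv, hlt⟩)
      exact hadj j u (mem_erase.2 ⟨huc, hu⟩) v (mem_erase.2 ⟨hvc, hv⟩) huv' _
        ((hW u hu).1 (hf1 u hu)) _ ((hW v hv).1 (hf1 v hv))

end ErdosHajnal

end Tournament

theorem stmt5 {n₁ n₂ : ℕ} (H₁ : Tournament n₁) (H₂ : Tournament n₂)
    (h₁ : H₁.IsCentralNebula) (h₂ : H₂.IsLRDeltaGalaxy) : EHPair H₁ H₂ := by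
  obtain ⟨C, M, hC, hM, hcontains⟩ := exists_contains_of_isNearCritical h₁ h₂
  obtain ⟨ε, hε, h⟩ := exists_eps_forall_isNearCritical hC hM
  refine ⟨ε, hε, fun n T hT₁ hT₂ => (h n T).resolve_right ?_⟩
  rintro ⟨U, hU⟩
  exact hT₂ (hcontains n T U hT₁ hU)
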